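/- Let L ⊆ K be number fields with [K : L] = 2, let 𝒪_L and 𝒪_K be their rings of integers, and for x ≥ 2 set f(x) = #{𝔓 : 𝔓 a nonzero prime ideal of 𝒪_L whose absolute norm N(𝔓) is a rational prime with N(𝔓) ≤ x, and such that the extended ideal 𝔓·𝒪_K is a prime ideal of 𝒪_K}. Then f(x) ~ (1/2)∫₂ˣ dt/log t as x → ∞, i.e., the ratio f(x)/((1/2)∫₂ˣ dt/log t) tends to 1. -/

import Mathlib

section
open NumberField NumberField.mixedEmbedding NumberField.mixedEmbedding.fundamentalCone MeasureTheory
open NumberField.InfinitePlace NumberField.Units NumberField.Units.dirichletUnitTheorem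

namespace PIT
section G1
variable (K : Type*) [Field K] [NumberField K]

open scoped Classical in
theorem vol_pre : ∃ c : ENNReal, c ≠ ⊤ ∧ ∀ Q : Set (realSpace K), MeasurableSet Q →
    volume ((normAtAllPlaces : mixedSpace K → realSpace K) ⁻¹' (expMapBasis '' Q)) =
    c * ∫⁻ x in Q, ENNReal.ofReal (Real.exp (x w₀ * Module.finrank ℚ K)) := by
  refine ⟨2 ^ nrRealPlaces K * .ofReal (2 * Real.pi) ^ nrComplexPlaces K *
    ((2 : ENNReal)⁻¹ ^ nrComplexPlaces K * ENNReal.ofReal (regulator K) * (Module.finrank ℚ K)),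
    ?_, fun Q hQ => ?_⟩
  · finiteness
  · have hm : MeasurableSet (expMapBasis '' Q : Set (realSpace K)) :=
      hQ.image_of_continuousOn_injOn (continuous_expMapBasis K).continuousOn
        (injective_expMapBasis K).injOn
    rw [volume_eq_two_pow_mul_two_pi_pow_mul_integral
      (by rw [normAtAllPlaces_image_preimage_expMapBasis])
      ((continuous_normAtAllPlaces K).measurable hm),
      normAtAllPlaces_image_preimage_expMapBasis,
      setLIntegral_expMapBasis_image hQ (by fun_prop)]
    simp_rw [ENNReal.inv_mul_cancel_right
      (Finset.prod_ne_zero_iff.mpr fun _ _ ↦ ENNReal.ofReal_ne_zero_iff.mpr (expMapBasis_pos _ _))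
      (ENNReal.prod_ne_top fun _ _ ↦ ENNReal.ofReal_ne_top)]
    simp only [mul_assoc]

open scoped Classical in
theorem box_int (I : InfinitePlace K → Set ℝ) (n : ℕ) :
    ∫⁻ x : realSpace K in Set.univ.pi I, ENNReal.ofReal (Real.exp (x w₀ * n)) =
    (∫⁻ t in I w₀, ENNReal.ofReal (Real.exp (t * n))) * ∏ i ∈ Finset.univ.erase w₀, volume (I i) := by
  rw [volume_pi, Measure.restrict_pi_pi, lintegral_eq_lmarginal_univ 0,
    lmarginal_erase' _ (by fun_prop) (Finset.mem_univ w₀)]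
  simp_rw [Function.update_self, lmarginal, lintegral_const, Measure.pi_univ,
    Measure.restrict_apply_univ]
  congr 1
  exact Finset.prod_coe_sort (Finset.univ.erase w₀) (fun i => volume (I i))

theorem int_Iic (b : ℝ) {n : ℕ} (hn : 0 < n) : 
    ∫⁻ t in Set.Iic b, ENNReal.ofReal (Real.exp (t * n)) = ENNReal.ofReal (Real.exp (n * b) / n) := by
  have hn : 0 < (n : ℝ) := Nat.cast_pos.mpr hn
  simp_rw [mul_comm _ (n : ℝ)]
  rw [← ofReal_integral_eq_lintegral_ofReal (integrableOn_exp_mul_Iic hn _), integral_exp_mul_Iic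
    hn]
  filter_upwards with _ using Real.exp_nonneg _

/-- the shell -/
def Shell (η : ℝ) : Set (realSpace K) :=
  {c | c w₀ ≤ η ∧ (∀ w, w ≠ w₀ → c w ∈ Set.Icc (-η) (1+η)) ∧
    ((-η ≤ c w₀) ∨ ∃ w, w ≠ w₀ ∧ (c w ≤ η ∨ 1 - η ≤ c w))}

open scoped Classical in
set_option maxHeartbeats 1000000 in
theorem shell_int : ∃ C : ℝ, 0 ≤ C ∧ ∀ η, 0 < η → η ≤ 1 → 
    volume ((normAtAllPlaces : mixedSpace K → realSpace K) ⁻¹' (expMapBasis '' Shell K η)) 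
      ≤ ENNReal.ofReal (C * η) := by
  obtain ⟨c, hc, h⟩ := vol_pre K
  set n := Module.finrank ℚ K with hn
  have hn0 : 0 < n := Module.finrank_pos
  have hm (w : InfinitePlace K) : (0:ℝ) < n := by exact_mod_cast hn0
  -- boxes
  let Q0 : ℝ → InfinitePlace K → Set ℝ := fun η w => if w = w₀ then Set.Icc (-η) η else Set.Icc (-1) 2
  let Q1 : ℝ → InfinitePlace K → InfinitePlace K → Set ℝ := fun η i w => if w = w₀ then Set.Iic 1 
    else if w = i then Set.Icc (-η) η else Set.Icc (-1) 2
  let Q2 : ℝ → InfinitePlace K → InfinitePlace K → Set ℝ := fun η i w => if w = w₀ then Set.Iic 1 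
    else if w = i then Set.Icc (1-η) (1+η) else Set.Icc (-1) 2
  have hQ0m : ∀ η, MeasurableSet (Set.univ.pi (Q0 η)) := fun η => MeasurableSet.univ_pi fun w => by
    simp only [Q0]; split_ifs <;> simp
  have hQ1m : ∀ η i, MeasurableSet (Set.univ.pi (Q1 η i)) := fun η i => MeasurableSet.univ_pi fun w => by
    simp only [Q1]; split_ifs <;> simp
  have hQ2m : ∀ η i, MeasurableSet (Set.univ.pi (Q2 η i)) := fun η i => MeasurableSet.univ_pi fun w => by
    simp only [Q2]; split_ifs <;> simp
  let T : Finset (InfinitePlace K) := Finset.univ.erase w₀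
  let R : ℝ → Set (realSpace K) := fun η => Set.univ.pi (Q0 η) ∪
    ⋃ i ∈ T, (Set.univ.pi (Q1 η i) ∪ Set.univ.pi (Q2 η i))
  have hsub : ∀ η, 0 < η → η ≤ 1 → Shell K η ⊆ R η := by
    rintro η h0 h1 x ⟨hx1, hx2, hx3⟩
    have key : ∀ w, w ≠ w₀ → x w ∈ Set.Icc (-1:ℝ) 2 := fun w hw => by
      have := hx2 w hw
      constructor <;> linarith [this.1, this.2]
    rcases hx3 with h | ⟨i, hi, h | h⟩
    · left
      intro w _
      simp only [Q0]
      split_ifs with hw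
      · subst hw; exact ⟨h, hx1⟩
      · exact key w hw
    · right
      refine Set.mem_biUnion (x := i) (by simp [T, hi]) (Or.inl ?_)
      intro w _
      simp only [Q1]
      split_ifs with hw hw2
      · subst hw; exact hx1.trans h1
      · subst hw2; exact ⟨(hx2 w hi).1, h⟩
      · exact key w hw
    · right
      refine Set.mem_biUnion (x := i) (by simp [T, hi]) (Or.inr ?_)
      intro w _
      simp only [Q2]
      split_ifs with hw hw2
      · subst hw; exact hx1.trans h1
      · subst hw2; exact ⟨h, (hx2 w hi).2⟩
      · exact key w hw
  -- the constant
  let D0 : ENNReal := c * (ENNReal.ofReal (Real.exp n) * 2 * ∏ i ∈ T, 3)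
  let D1 : ENNReal := c * (ENNReal.ofReal (Real.exp (n * 1) / n) * (2 * ∏ i ∈ T, 3))
  let D : ENNReal := D0 + ∑ i ∈ T, (D1 + D1)
  have hD : D ≠ ⊤ := by
    have hp : ∏ i ∈ T, (3:ENNReal) ≠ ⊤ := ENNReal.prod_ne_top fun _ _ => by norm_num
    have h0 : D0 ≠ ⊤ := ENNReal.mul_ne_top hc (ENNReal.mul_ne_top
      (ENNReal.mul_ne_top ENNReal.ofReal_ne_top (by norm_num)) hp)
    have h1 : D1 ≠ ⊤ := ENNReal.mul_ne_top hc (ENNReal.mul_ne_top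
      ENNReal.ofReal_ne_top (ENNReal.mul_ne_top (by norm_num) hp))
    exact ENNReal.add_ne_top.2 ⟨h0, ENNReal.sum_ne_top.2 fun _ _ => ENNReal.add_ne_top.2 ⟨h1, h1⟩⟩
  have v0 : ∀ η, 0 < η → η ≤ 1 → 
      volume ((normAtAllPlaces : mixedSpace K → realSpace K) ⁻¹' (expMapBasis '' Set.univ.pi (Q0 η))) 
      ≤ D0 * ENNReal.ofReal η := by
    intro η h0 h1
    rw [h _ (hQ0m η), box_int]
    simp only [D0]
    rw [mul_assoc c]
    refine mul_le_mul_right ?_ _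
    rw [mul_assoc, mul_assoc, mul_comm (∏ i ∈ T, (3:ENNReal)), ← mul_assoc, ← mul_assoc]
    refine mul_le_mul' ?_ (Finset.prod_le_prod' fun i hi => ?_)
    · simp only [Q0, if_true]
      calc ∫⁻ t in Set.Icc (-η) η, ENNReal.ofReal (Real.exp (t * n)) 
        ≤ ∫⁻ t in Set.Icc (-η) η, ENNReal.ofReal (Real.exp n) := by
            refine setLIntegral_mono measurable_const fun t ht => ?_
            gcongr
            have := ht.2
            nlinarith [hm w₀]
        _ = _ := by
            rw [setLIntegral_const, Real.volume_Icc, mul_assoc]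
            congr 1
            rw [show η - -η = 2 * η by ring, ENNReal.ofReal_mul (by norm_num)]
            simp
    · rw [Finset.mem_erase] at hi
      simp only [Q0, if_neg hi.1, Real.volume_Icc]
      norm_num
  have prod_aux : ∀ (η : ℝ) (i : InfinitePlace K) (hi : i ∈ T) (f : InfinitePlace K → ENNReal),
      f i = 2 * ENNReal.ofReal η → (∀ j ∈ T, j ≠ i → f j ≤ 3) → 
      ∏ j ∈ T, f j ≤ (2 * ∏ i ∈ T, (3:ENNReal)) * ENNReal.ofReal η := by
    intro η i hi f hf hf2
    rw [← Finset.mul_prod_erase _ _ hi, hf, mul_assoc, mul_assoc, mul_comm (ENNReal.ofReal η)]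
    gcongr
    calc ∏ j ∈ T.erase i, f j ≤ ∏ j ∈ T.erase i, 3 := by
          refine Finset.prod_le_prod' fun j hj => ?_
          rw [Finset.mem_erase] at hj
          exact hf2 j hj.2 hj.1
      _ ≤ _ := by
          refine Finset.prod_le_prod_of_subset_of_one_le' (Finset.erase_subset _ _) ?_
          intros; norm_num
  have v1 : ∀ η, 0 < η → η ≤ 1 → ∀ i ∈ T,
      volume ((normAtAllPlaces : mixedSpace K → realSpace K) ⁻¹' (expMapBasis '' Set.univ.pi (Q1 η i))) 
      ≤ D1 * ENNReal.ofReal η := by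
    intro η h0 h1 i hi
    rw [h _ (hQ1m η i), box_int]
    simp only [D1]
    rw [mul_assoc c, mul_assoc (ENNReal.ofReal _)]
    have : Q1 η i w₀ = Set.Iic 1 := by simp [Q1]
    rw [this, int_Iic _ hn0]
    gcongr
    have hi0 : i ≠ w₀ := (Finset.mem_erase.1 hi).1
    refine prod_aux η i hi (fun j => volume (Q1 η i j)) ?_ ?_
    · simp only [Q1, if_neg hi0, if_true, Real.volume_Icc]
      rw [show η - -η = 2 * η by ring, ENNReal.ofReal_mul (by norm_num)]
      simp
    · intro j hj hji
      have hj0 : j ≠ w₀ := (Finset.mem_erase.1 hj).1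
      simp only [Q1, if_neg hj0, if_neg hji, Real.volume_Icc]
      norm_num
  have v2 : ∀ η, 0 < η → η ≤ 1 → ∀ i ∈ T,
      volume ((normAtAllPlaces : mixedSpace K → realSpace K) ⁻¹' (expMapBasis '' Set.univ.pi (Q2 η i))) 
      ≤ D1 * ENNReal.ofReal η := by
    intro η h0 h1 i hi
    rw [h _ (hQ2m η i), box_int]
    simp only [D1]
    rw [mul_assoc c, mul_assoc (ENNReal.ofReal _)]
    have : Q2 η i w₀ = Set.Iic 1 := by simp [Q2]
    rw [this, int_Iic _ hn0]
    gcongr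
    have hi0 : i ≠ w₀ := (Finset.mem_erase.1 hi).1
    refine prod_aux η i hi (fun j => volume (Q2 η i j)) ?_ ?_
    · simp only [Q2, if_neg hi0, if_true, Real.volume_Icc]
      rw [show 1 + η - (1 - η) = 2 * η by ring, ENNReal.ofReal_mul (by norm_num)]
      simp
    · intro j hj hji
      have hj0 : j ≠ w₀ := (Finset.mem_erase.1 hj).1
      simp only [Q2, if_neg hj0, if_neg hji, Real.volume_Icc]
      norm_num
  refine ⟨D.toReal, ENNReal.toReal_nonneg, fun η h0 h1 => ?_⟩
  rw [ENNReal.ofReal_mul ENNReal.toReal_nonneg, ENNReal.ofReal_toReal hD]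
  calc _ ≤ volume ((normAtAllPlaces : mixedSpace K → realSpace K) ⁻¹' (expMapBasis '' R η)) := by
        gcongr; exact hsub η h0 h1
    _ ≤ _ := by
        simp only [R, Set.image_union, Set.preimage_union, Set.image_iUnion, Set.preimage_iUnion]
        refine (measure_union_le _ _).trans ?_
        rw [show D * ENNReal.ofReal η = D0 * ENNReal.ofReal η + ∑ i ∈ T, (D1 * ENNReal.ofReal η + D1 * ENNReal.ofReal η) by
          simp only [D, add_mul, Finset.sum_mul]]
        refine add_le_add (v0 η h0 h1) ?_
        refine (measure_biUnion_finset_le _ _).trans ?_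
        refine Finset.sum_le_sum fun i hi => (measure_union_le _ _).trans ?_
        exact add_le_add (v1 η h0 h1 i hi) (v2 η h0 h1 i hi)
end G1
end PIT
end

section
open NumberField NumberField.mixedEmbedding NumberField.mixedEmbedding.fundamentalCone MeasureTheory
open NumberField.InfinitePlace NumberField.Units NumberField.Units.dirichletUnitTheorem

namespace PIT
/-- points within `ε` of a point on the other side of `S` -/
def bd {E : Type*} [NormedAddCommGroup E] (ε : ℝ) (S : Set E) : Set E :=
  {x | ∃ y, ‖x - y‖ ≤ ε ∧ ((x ∈ S ∧ y ∉ S) ∨ (x ∉ S ∧ y ∈ S))}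

theorem log_diff {a b m : ℝ} (hm : 0 < m) (ha : m ≤ a) (hb : m ≤ b) :
    |Real.log a - Real.log b| ≤ |a - b| / m := by
  wlog h : b ≤ a generalizing a b
  · rw [abs_sub_comm, abs_sub_comm a]; exact this hb ha (le_of_not_ge h)
  have hb0 : 0 < b := by linarith
  have ha0 : 0 < a := by linarith
  rw [abs_of_nonneg (sub_nonneg.2 (Real.log_le_log hb0 h)), abs_of_nonneg (sub_nonneg.2 h),
    ← Real.log_div ha0.ne' hb0.ne']
  calc Real.log (a/b) ≤ a / b - 1 := Real.log_le_sub_one_of_pos (by positivity)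
    _ = (a - b) / b := by field_simp
    _ ≤ _ := by gcongr

section G2
variable (K : Type*) [Field K] [NumberField K]

open scoped Classical in
theorem nap_le (x : mixedSpace K) (w : InfinitePlace K) : normAtPlace w x ≤ ‖x‖ := by
  rw [norm_eq_sup'_normAtPlace]
  exact Finset.le_sup' (fun w => normAtPlace w x) (Finset.mem_univ w)

open scoped Classical in
theorem nap_sub (x y : mixedSpace K) (w : InfinitePlace K) :
    |normAtPlace w x - normAtPlace w y| ≤ ‖x - y‖ := by
  rw [abs_le]
  have h1 := normAtPlace_add_le w (x - y) y
  have h2 := normAtPlace_add_le w (y - x) x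
  rw [sub_add_cancel] at h1 h2
  have h3 := nap_le K (x - y) w
  have h4 := nap_le K (y - x) w
  rw [norm_sub_rev] at h4
  constructor <;> linarith

theorem shell_of {c c' : realSpace K} {η : ℝ} (h0 : 0 < η) (hc : c ∈ paramSet K) (hc' : c' ∉ paramSet K)
    (h : ∀ w, |c w - c' w| ≤ η) : c ∈ Shell K η ∧ c' ∈ Shell K η := by
  classical
  simp only [paramSet, Set.mem_univ_pi, not_forall] at hc hc'
  obtain ⟨w, hw⟩ := hc'
  have hc0 : c w₀ ≤ 0 := by simpa using hc w₀
  have hci : ∀ i, i ≠ w₀ → c i ∈ Set.Ico (0:ℝ) 1 := fun i hi => by simpa [hi] using hc i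
  have hh : ∀ w, -η ≤ c w - c' w ∧ c w - c' w ≤ η := fun w => abs_le.1 (h w)
  have hw0 := hh w₀
  have hww := hh w
  refine ⟨⟨by linarith, fun i hi => ?_, ?_⟩, ⟨by linarith, fun i hi => ?_, ?_⟩⟩
  · have := hci i hi
    constructor <;> linarith [this.1, this.2]
  · by_cases hw1 : w = w₀
    · left
      subst hw1
      simp at hw
      linarith
    · right
      simp [hw1] at hw
      refine ⟨w, hw1, ?_⟩
      by_cases h3 : 0 ≤ c' w
      · right; have := hw h3; linarith
      · left; linarith
  · have := hci i hi
    have := hh i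
    constructor <;> linarith [(hci i hi).1, (hci i hi).2, (hh i).1, (hh i).2]
  · by_cases hw1 : w = w₀
    · left
      subst hw1
      simp at hw
      linarith
    · right
      simp [hw1] at hw
      refine ⟨w, hw1, ?_⟩
      by_cases h3 : 0 ≤ c' w
      · right; have := hw h3; linarith
      · left; linarith

theorem exists_M : ∃ M : ℝ, 1 ≤ M ∧ ∀ c ∈ paramSet K, ∀ w,
    Real.exp (c w₀) / M ≤ expMapBasis c w ∧ expMapBasis c w ≤ M * Real.exp (c w₀) := by
  classical
  let B : Set (realSpace K) := Set.univ.pi fun w ↦ if w = w₀ then {0} else Set.Icc 0 1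
  have hB : IsCompact B := isCompact_univ_pi fun w => by split_ifs <;> simp [isCompact_Icc]
  let f : realSpace K → ℝ := fun c => ∑ w, (expMapBasis c w + (expMapBasis c w)⁻¹)
  have hcont : Continuous f := by
    refine continuous_finsetSum _ fun w _ => ?_
    have h1 : Continuous fun c : realSpace K => expMapBasis c w := 
      (continuous_apply w).comp (continuous_expMapBasis K)
    exact h1.add (h1.inv₀ fun c => (expMapBasis_pos c w).ne')
  obtain ⟨M, hM⟩ := hB.bddAbove_image hcont.continuousOn
  refine ⟨max M 1, le_max_right _ _, fun c hc w => ?_⟩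
  rw [expMapBasis_apply'']
  set c1 : realSpace K := fun i ↦ if i = w₀ then 0 else c i with hc1
  have hc1B : c1 ∈ B := by
    intro i _
    simp only [c1]
    split_ifs with hi
    · simp
    · have := hc i (Set.mem_univ _)
      simp only [if_neg hi] at this
      exact Set.Ico_subset_Icc_self this
  have hp := expMapBasis_pos c1 w
  have hle : expMapBasis c1 w + (expMapBasis c1 w)⁻¹ ≤ M := by
    refine le_trans ?_ (hM (Set.mem_image_of_mem f hc1B))
    refine Finset.single_le_sum (f := fun w => expMapBasis c1 w + (expMapBasis c1 w)⁻¹) (fun w _ => ?_) (Finset.mem_univ w)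
    have hp := expMapBasis_pos c1 w
    positivity
  have hi : 0 < (expMapBasis c1 w)⁻¹ := by positivity
  have hM1 : M ≤ max M 1 := le_max_left _ _
  have hM0 : 0 < max M 1 := by positivity
  simp only [Pi.smul_apply, smul_eq_mul]
  have he := Real.exp_pos (c w₀)
  constructor
  · rw [div_eq_mul_inv]
    gcongr
    rw [inv_le_comm₀ hM0 hp]
    linarith
  · rw [mul_comm]; gcongr; linarith

theorem exists_Lip : ∃ C : ℝ, 0 < C ∧ ∀ u v : realSpace K, ∀ δ : ℝ, 0 ≤ δ → 
    (∀ w, |Real.log (u w) - Real.log (v w)| ≤ δ) → 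
    ∀ w, |expMapBasis.symm u w - expMapBasis.symm v w| ≤ C * δ := by
  let T : realSpace K →L[ℝ] realSpace K := (completeBasis K).equivFunL
  refine ⟨2 * (‖T‖ + 1), by positivity, fun u v δ hδ h w => ?_⟩
  have e : ∀ u, expMapBasis.symm u = T (expMap.symm u) := fun u => rfl
  rw [e, e, ← Pi.sub_apply, ← map_sub, ← Real.norm_eq_abs]
  refine (norm_le_pi_norm _ w).trans ((T.le_opNorm _).trans ?_)
  have : ‖expMap.symm u - expMap.symm v‖ ≤ 2 * δ := by
    rw [pi_norm_le_iff_of_nonneg (by positivity)]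
    intro w
    rw [Pi.sub_apply, expMap_symm_apply, expMap_symm_apply, ← mul_sub, norm_mul, Real.norm_eq_abs, Real.norm_eq_abs]
    have hm : (w.mult : ℝ) ≤ 2 := by
      unfold InfinitePlace.mult; split_ifs <;> norm_num
    gcongr
    · rw [abs_of_nonneg (by positivity)]; exact hm
    · exact h w
  calc _ ≤ ‖T‖ * (2 * δ) := by gcongr
    _ ≤ (‖T‖ + 1) * (2 * δ) := by gcongr; linarith
    _ = _ := by ring

open scoped Classical in
theorem bd_key : ∃ C1 C2 : ℝ, 0 < C1 ∧ 0 < C2 ∧ ∀ ε : ℝ, 0 < ε → ε ≤ 1 → ∀ s o : mixedSpace K,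
    s ∈ normLeOne K → o ∉ normLeOne K → ‖s - o‖ ≤ ε → 
    (‖s‖ ≤ C1 * √ε ∨ (normAtAllPlaces s ∈ expMapBasis '' Shell K (C2 * √ε) ∧ 
      normAtAllPlaces o ∈ expMapBasis '' Shell K (C2 * √ε))) := by
  obtain ⟨M, hM1, hM⟩ := exists_M K
  obtain ⟨C, hC, hL⟩ := exists_Lip K
  refine ⟨2 * M * M, C, by positivity, hC, fun ε h0 h1 s o hs ho hso => ?_⟩
  rw [normLeOne_eq_preimage, Set.mem_preimage] at hs ho
  obtain ⟨c, hc, hcs⟩ := hs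
  have hsq : 0 < √ε := Real.sqrt_pos.2 h0
  have hsq2 : √ε * √ε = ε := Real.mul_self_sqrt h0.le
  have hsq1 : √ε ≤ 1 := Real.sqrt_le_one.2 h1
  have hεs : ε ≤ √ε := by nlinarith
  have hsw : ∀ w, normAtPlace w s = expMapBasis c w := fun w => by
    rw [hcs, normAtAllPlaces_apply]
  by_cases hbig : 2 * M * √ε ≤ Real.exp (c w₀)
  · right
    have h2 : ∀ w, 2 * √ε ≤ normAtPlace w s := fun w => by
      rw [hsw]
      refine le_trans ?_ (hM c hc w).1
      rw [le_div_iff₀ (by positivity)]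
      linarith
    have h3 : ∀ w, √ε ≤ normAtPlace w o := fun w => by
      have := (abs_le.1 ((nap_sub K s o w).trans hso)).2
      have := h2 w
      linarith
    set c' := expMapBasis.symm (normAtAllPlaces o) with hc'
    have hco : expMapBasis c' = normAtAllPlaces o := 
      expMapBasis.right_inv (Set.mem_univ_pi.mpr fun w => by
        change 0 < normAtAllPlaces o w
        rw [normAtAllPlaces_apply]; exact lt_of_lt_of_le hsq (h3 w))
    have hcc : c = expMapBasis.symm (normAtAllPlaces s) := by
      rw [← hcs, expMapBasis.left_inv (by simp [expMapBasis_source])]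
    have hclose : ∀ w, |c w - c' w| ≤ C * √ε := by
      rw [hcc, hc']
      refine hL _ _ _ hsq.le fun w => ?_
      rw [normAtAllPlaces_apply, normAtAllPlaces_apply]
      refine (log_diff hsq (by linarith [h2 w]) (h3 w)).trans ?_
      rw [div_le_iff₀ hsq, hsq2]
      exact (nap_sub K s o w).trans hso
    have hc'n : c' ∉ paramSet K := fun h => ho ⟨c', h, hco⟩
    obtain ⟨a, b⟩ := shell_of K (by positivity) hc hc'n hclose
    exact ⟨⟨c, a, hcs⟩, ⟨c', b, hco⟩⟩
  · left
    push Not at hbig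
    rw [norm_eq_sup'_normAtPlace]
    refine Finset.sup'_le _ _ fun w _ => ?_
    rw [hsw]
    refine (hM c hc w).2.trans ?_
    nlinarith

open scoped Classical in
theorem bd_vol : ∃ C ε0 : ℝ, 0 ≤ C ∧ 0 < ε0 ∧ ∀ ε : ℝ, 0 < ε → ε ≤ ε0 → 
    volume (bd ε (normLeOne K)) ≤ ENNReal.ofReal (C * √ε) := by
  classical
  obtain ⟨C1, C2, hC1, hC2, hkey⟩ := bd_key K
  obtain ⟨C, hC, hS⟩ := shell_int K
  set n := Module.finrank ℝ (mixedSpace K) with hn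
  have hn0 : 0 < n := Module.finrank_pos
  let V := (volume (Metric.closedBall (0 : mixedSpace K) 1)).toReal
  refine ⟨V * (C1 + 1) + C * C2, min 1 (min ((C1+1)⁻¹^2) (C2⁻¹^2)), by positivity, by positivity, fun ε h0 h1 => ?_⟩
  have hε1 : ε ≤ 1 := h1.trans (min_le_left _ _)
  have hε2 : √ε ≤ (C1+1)⁻¹ := Real.sqrt_le_iff.2 ⟨by positivity, h1.trans ((min_le_right _ _).trans (min_le_left _ _))⟩
  have hε3 : √ε ≤ C2⁻¹ := Real.sqrt_le_iff.2 ⟨by positivity, h1.trans ((min_le_right _ _).trans (min_le_right _ _))⟩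
  have hsq : 0 < √ε := Real.sqrt_pos.2 h0
  have hsq2 : √ε * √ε = ε := Real.mul_self_sqrt h0.le
  have hsq1 : √ε ≤ 1 := Real.sqrt_le_one.2 hε1
  have hεs : ε ≤ √ε := by nlinarith
  have hsub : bd ε (normLeOne K) ⊆ Metric.closedBall 0 ((C1+1) * √ε) ∪ 
      (normAtAllPlaces : mixedSpace K → realSpace K) ⁻¹' (expMapBasis '' Shell K (C2 * √ε)) := by
    rintro x ⟨y, hxy, ⟨hx, hy⟩ | ⟨hx, hy⟩⟩
    · rcases hkey ε h0 hε1 x y hx hy hxy with h | ⟨h, -⟩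
      · left
        rw [mem_closedBall_zero_iff]; linarith
      · right; exact h
    · rw [norm_sub_rev] at hxy
      rcases hkey ε h0 hε1 y x hy hx hxy with h | ⟨-, h⟩
      · left
        rw [mem_closedBall_zero_iff]
        have : ‖x‖ ≤ ‖y‖ + ‖y - x‖ := by
          rw [norm_sub_rev]
          calc ‖x‖ = ‖y + (x - y)‖ := by congr 1; abel
            _ ≤ _ := norm_add_le _ _
        linarith
      · right; exact h
  refine (measure_mono hsub).trans ((measure_union_le _ _).trans ?_)
  rw [add_mul (V * (C1 + 1)), ENNReal.ofReal_add (by positivity) (by positivity)]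
  refine add_le_add ?_ ?_
  · rw [Measure.addHaar_closedBall' _ _ (by positivity), mul_assoc, ENNReal.ofReal_mul' (by positivity),
      ENNReal.ofReal_toReal (by exact (isCompact_closedBall _ _).measure_ne_top), mul_comm]
    gcongr
    refine pow_le_of_le_one (by positivity) ?_ hn0.ne'
    calc (C1+1) * √ε ≤ (C1+1) * (C1+1)⁻¹ := by gcongr
      _ = 1 := by field_simp
  · refine (hS _ (by positivity) ?_).trans ?_
    · calc C2 * √ε ≤ C2 * C2⁻¹ := by gcongr
        _ = 1 := by field_simp
    · rw [mul_assoc]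
end G2
end PIT
end

section
open NumberField NumberField.mixedEmbedding NumberField.mixedEmbedding.fundamentalCone MeasureTheory
open NumberField.InfinitePlace NumberField.Units NumberField.Units.dirichletUnitTheorem

namespace PIT
section lattice
open scoped Pointwise
variable {E : Type*} [NormedAddCommGroup E] [NormedSpace ℝ E] [MeasurableSpace E] [BorelSpace E]
  [FiniteDimensional ℝ E] (μ : Measure E) [μ.IsAddHaarMeasure]

theorem lat_count {ι : Type*} [Fintype ι] (b : Module.Basis ι ℝ E) (R : ℝ)
    (hR : ∀ x ∈ ZSpan.fundamentalDomain b, ‖x‖ ≤ R) (S : Set E) 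
    (hfin : (S ∩ (Submodule.span ℤ (Set.range b) : Set E)).Finite) :
    (Nat.card ↑(S ∩ (Submodule.span ℤ (Set.range b) : Set E))) * μ (ZSpan.fundamentalDomain b) ≤ 
      μ S + μ (bd R S) ∧
    μ S ≤ (Nat.card ↑(S ∩ (Submodule.span ℤ (Set.range b) : Set E))) * μ (ZSpan.fundamentalDomain b) 
      + μ (bd R S) := by
  classical
  set D := ZSpan.fundamentalDomain b with hD
  set Λ := Submodule.span ℤ (Set.range b)
  have hmD : MeasurableSet D := ZSpan.fundamentalDomain_measurableSet b
  let U : Set E := ⋃ l ∈ hfin.toFinset, (fun x => -l + x) ⁻¹' D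
  have hU : μ U = (Nat.card ↑(S ∩ (Λ : Set E))) * μ D := by
    rw [measure_biUnion_finset]
    · simp_rw [measure_preimage_add]
      rw [Finset.sum_const, nsmul_eq_mul, Nat.card_coe_set_eq, Set.ncard_eq_toFinset_card _ hfin]
    · intro l hl l' hl' hne
      rw [Function.onFun, Set.disjoint_left]
      intro x hx hx'
      simp only [Set.Finite.coe_toFinset, Set.mem_inter_iff] at hl hl'
      apply hne
      have := (ZSpan.exist_unique_vadd_mem_fundamentalDomain b x).unique 
        (y₁ := ⟨-l, neg_mem hl.2⟩) (y₂ := ⟨-l', neg_mem hl'.2⟩) hx hx'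
      simpa using congrArg Subtype.val this
    · intro l _
      exact (measurable_const_add (-l)) hmD
  rw [← hU]
  constructor
  · refine (measure_mono ?_).trans (measure_union_le _ _)
    intro x hx
    simp only [U, Set.mem_iUnion, Set.Finite.mem_toFinset] at hx
    obtain ⟨l, hl, hx⟩ := hx
    by_cases hxS : x ∈ S
    · left; exact hxS
    · right
      refine ⟨l, ?_, Or.inr ⟨hxS, hl.1⟩⟩
      rw [sub_eq_neg_add]
      exact hR _ hx
  · refine (measure_mono ?_).trans (measure_union_le _ _)
    intro x hx
    obtain ⟨v, hv, -⟩ := ZSpan.exist_unique_vadd_mem_fundamentalDomain b x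
    by_cases hvS : (-(v : E)) ∈ S
    · left
      simp only [U, Set.mem_iUnion, Set.Finite.mem_toFinset]
      refine ⟨-(v:E), ⟨hvS, neg_mem v.2⟩, ?_⟩
      have : -(-(v:E)) + x = v +ᵥ x := by rw [neg_neg]; rfl
      change -(-(v:E)) + x ∈ D
      rw [this]; exact hv
    · right
      refine ⟨-(v:E), ?_, Or.inl ⟨hx, hvS⟩⟩
      have := hR _ hv
      rw [sub_neg_eq_add, add_comm]
      exact this

theorem bd_smul (S : Set E) {τ R : ℝ} (hτ : 0 < τ) : bd R (τ • S) = τ • bd (R / τ) S := by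
  ext x
  rw [Set.mem_smul_set_iff_inv_smul_mem₀ hτ.ne']
  simp only [bd, Set.mem_ofPred_eq, Set.mem_smul_set_iff_inv_smul_mem₀ hτ.ne']
  constructor
  · rintro ⟨y, h1, h2⟩
    refine ⟨τ⁻¹ • y, ?_, h2⟩
    rw [← smul_sub, _root_.norm_smul, Real.norm_of_nonneg (by positivity), ← div_eq_inv_mul]
    gcongr
  · rintro ⟨y, h1, h2⟩
    refine ⟨τ • y, ?_, by simpa [smul_smul, hτ.ne'] using h2⟩
    have : x - τ • y = τ • (τ⁻¹ • x - y) := by rw [smul_sub, smul_smul, mul_inv_cancel₀ hτ.ne', one_smul]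
    rw [this, _root_.norm_smul, Real.norm_of_nonneg hτ.le]
    rw [le_div_iff₀ hτ] at h1
    linarith

theorem lat_count' {ι : Type*} [Fintype ι] (b : Module.Basis ι ℝ E) (S : Set E) 
    (hS : Bornology.IsBounded S) 
    (hbd : ∃ C ε0 : ℝ, 0 ≤ C ∧ 0 < ε0 ∧ ∀ ε : ℝ, 0 < ε → ε ≤ ε0 → μ (bd ε S) ≤ ENNReal.ofReal (C * √ε)) :
    ∃ C c τ0 : ℝ, 0 ≤ C ∧ 0 < τ0 ∧ ∀ τ : ℝ, τ0 ≤ τ → 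
    |(Nat.card ↑(τ • S ∩ (Submodule.span ℤ (Set.range b) : Set E)) : ℝ) - c * τ ^ Module.finrank ℝ E| ≤ 
      C * (τ ^ Module.finrank ℝ E / √τ) := by
  obtain ⟨C, ε0, hC, hε0, hbd⟩ := hbd
  obtain ⟨R, hR1, hR⟩ := (ZSpan.fundamentalDomain_isBounded b).exists_pos_norm_le
  set D := ZSpan.fundamentalDomain b with hD
  set n := Module.finrank ℝ E
  have hD0 : μ D ≠ 0 := ZSpan.measure_fundamentalDomain_ne_zero b
  have hDt : μ D ≠ ⊤ := (ZSpan.fundamentalDomain_isBounded b).measure_lt_top.ne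
  have hSt : μ S ≠ ⊤ := hS.measure_lt_top.ne
  have hd : 0 < (μ D).toReal := ENNReal.toReal_pos hD0 hDt
  refine ⟨C * √R / (μ D).toReal, (μ S).toReal / (μ D).toReal, R / ε0, by positivity, by positivity, fun τ hτ => ?_⟩
  have hτ0 : 0 < τ := lt_of_lt_of_le (by positivity) hτ
  have hfin : (τ • S ∩ (Submodule.span ℤ (Set.range b) : Set E)).Finite := 
    ZSpan.setFinite_inter b (hS.smul₀ τ)
  obtain ⟨h1, h2⟩ := lat_count μ b R hR (τ • S) hfin
  set N := Nat.card ↑(τ • S ∩ (Submodule.span ℤ (Set.range b) : Set E))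
  have hμS : μ (τ • S) = ENNReal.ofReal (τ ^ n) * μ S := by
    rw [Measure.addHaar_smul, abs_of_pos (by positivity)]
  have hμB : μ (bd R (τ • S)) ≤ ENNReal.ofReal (τ ^ n * (C * √(R / τ))) := by
    rw [bd_smul S hτ0, Measure.addHaar_smul, abs_of_pos (by positivity), ENNReal.ofReal_mul (by positivity)]
    gcongr
    refine hbd _ (by positivity) ?_
    rw [div_le_iff₀ hτ0, mul_comm, ← div_le_iff₀ hε0]
    exact hτ
  have hμS' : μ (τ • S) = ENNReal.ofReal (τ ^ n * (μ S).toReal) := by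
    rw [hμS, ENNReal.ofReal_mul (by positivity), ENNReal.ofReal_toReal hSt]
  have hN : (N : ENNReal) * μ D = ENNReal.ofReal (N * (μ D).toReal) := by
    rw [ENNReal.ofReal_mul (by positivity), ENNReal.ofReal_toReal hDt, ENNReal.ofReal_natCast]
  have h1' := h1.trans (add_le_add le_rfl hμB)
  have h2' := h2.trans (add_le_add le_rfl hμB)
  rw [hμS', hN, ← ENNReal.ofReal_add (by positivity) (by positivity), 
    ENNReal.ofReal_le_ofReal_iff (by positivity)] at h1' h2'
  have key : |(N : ℝ) * (μ D).toReal - τ ^ n * (μ S).toReal| ≤ τ ^ n * (C * √(R / τ)) := by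
    rw [abs_le]; constructor <;> linarith
  have e1 : (N : ℝ) - (μ S).toReal / (μ D).toReal * τ ^ n = 
    ((N : ℝ) * (μ D).toReal - τ ^ n * (μ S).toReal) / (μ D).toReal := by
    field_simp
  rw [e1, abs_div, abs_of_pos hd, div_le_iff₀ hd]
  refine key.trans (le_of_eq ?_)
  rw [Real.sqrt_div' _ hτ0.le]
  field_simp
end lattice
end PIT
end

section
open NumberField NumberField.mixedEmbedding NumberField.mixedEmbedding.fundamentalCone MeasureTheory
open NumberField.InfinitePlace NumberField.Units NumberField.Units.dirichletUnitTheorem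

namespace PIT
section G4
open scoped nonZeroDivisors Real Pointwise
open Filter Submodule Topology Ideal
variable (K : Type*) [Field K] [NumberField K]
variable {C : ClassGroup (𝓞 K)} {J : (Ideal (𝓞 K))⁰} {s : ℝ}

theorem aux1 (hJ : ClassGroup.mk0 J = C⁻¹) :
    Nat.card {I : (Ideal (𝓞 K))⁰ // absNorm (I : Ideal (𝓞 K)) ≤ s ∧ ClassGroup.mk0 I = C}
      = Nat.card {I : (Ideal (𝓞 K))⁰ // (J : Ideal (𝓞 K)) ∣ I ∧ IsPrincipal (I : Ideal (𝓞 K)) ∧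
        absNorm (I : Ideal (𝓞 K)) ≤ s * absNorm (J : Ideal (𝓞 K))} := by
  simp_rw [← nonZeroDivisors_dvd_iff_dvd_coe]
  refine Nat.card_congr ?_
  refine ((Equiv.dvd J).subtypeEquiv fun I ↦ ?_).trans
    (Equiv.subtypeSubtypeEquivSubtypeInter (fun I : (Ideal (𝓞 K))⁰ ↦ J ∣ I) _)
  rw [← ClassGroup.mk0_eq_one_iff (SetLike.coe_mem _)]
  simp_rw [Equiv.dvd_apply, Submonoid.coe_mul, ← Submonoid.mul_def, _root_.map_mul, hJ,
    inv_mul_eq_one, Nat.cast_mul, mul_comm s, eq_comm, and_comm, and_congr_left_iff]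
  exact fun _ ↦
    (mul_le_mul_iff_of_pos_left (Nat.cast_pos.mpr (absNorm_pos_of_nonZeroDivisors J))).symm

theorem smul_nlo {τ : ℝ} (hτ : 0 < τ) (x : mixedSpace K) : x ∈ τ • normLeOne K ↔ 
    x ∈ fundamentalCone K ∧ mixedEmbedding.norm x ≤ τ ^ Module.finrank ℚ K := by
  rw [Set.mem_smul_set_iff_inv_smul_mem₀ hτ.ne', mem_normLeOne, smul_mem_iff_mem (by positivity),
    mixedEmbedding.norm_smul, abs_of_pos (by positivity), inv_pow, inv_mul_le_iff₀ (by positivity), mul_one]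

open scoped Classical in
theorem aux2 {τ : ℝ} (hτ : 0 < τ) : 
    Nat.card {a : idealSet K J // mixedEmbedding.norm (a : mixedSpace K) ≤ τ ^ Module.finrank ℚ K} = 
    Nat.card ↑(τ • normLeOne K ∩ (Submodule.span ℤ (Set.range (fractionalIdealLatticeBasis K (FractionalIdeal.mk0 K J))) : Set (mixedSpace K))) := by
  refine Nat.card_congr ((Equiv.subtypeSubtypeEquivSubtypeInter _ (mixedEmbedding.norm · ≤ τ ^ Module.finrank ℚ K)).trans 
    (Equiv.subtypeEquivProp ?_))
  ext x
  rw [span_idealLatticeBasis]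
  simp_rw [mem_idealSet, Set.mem_inter_iff, smul_nlo K hτ, SetLike.mem_coe,
    mem_idealLattice, FractionalIdeal.coe_mk0]
  constructor
  · rintro ⟨⟨hx₁, x, hx₃, rfl⟩, hx₂⟩
    exact ⟨⟨hx₁, hx₂⟩, ⟨(x : K), by simp [hx₃], rfl⟩⟩
  · rintro ⟨⟨hx₁, hx₂⟩, _, ⟨x, hx₃, rfl⟩, h⟩
    exact ⟨⟨hx₁, x, hx₃, h⟩, hx₂⟩

theorem count_class (C : ClassGroup (𝓞 K)) : ∃ A c s0 : ℝ, 0 ≤ A ∧ 0 < s0 ∧ ∀ s : ℝ, s0 ≤ s → 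
    |(Nat.card {I : (Ideal (𝓞 K))⁰ // absNorm (I : Ideal (𝓞 K)) ≤ s ∧ ClassGroup.mk0 I = C} : ℝ) - c * s| ≤ 
    A * s ^ (1 - 1 / (2 * Module.finrank ℚ K) : ℝ) := by
  classical
  obtain ⟨J, hJ⟩ := ClassGroup.mk0_surjective C⁻¹
  obtain ⟨A, c, τ0, hA, hτ0, h⟩ := lat_count' volume (fractionalIdealLatticeBasis K (FractionalIdeal.mk0 K J))
    (normLeOne K) (isBounded_normLeOne K) (bd_vol K)
  rw [mixedEmbedding.finrank] at h
  set d := Module.finrank ℚ K with hd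
  have hd0 : 0 < d := Module.finrank_pos
  set n : ℝ := ((absNorm (J : Ideal (𝓞 K)) : ℕ) : ℝ) with hn
  have hn0 : 0 < n := Nat.cast_pos.mpr (absNorm_pos_of_nonZeroDivisors J)
  set t : ℝ := ((torsionOrder K : ℕ) : ℝ) with htt
  have ht : 0 < t := Nat.cast_pos.2 (torsionOrder_pos K)
  refine ⟨A * n ^ (1 - 1 / (2 * d) : ℝ) / t, c * n / t, τ0 ^ d / n, by positivity, by positivity, fun s hs => ?_⟩
  have hs0 : 0 < s := lt_of_lt_of_le (by positivity) hs
  set τ : ℝ := (s * n) ^ (1 / d : ℝ)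
  have hτd : τ ^ d = s * n := by
    rw [← Real.rpow_natCast, ← Real.rpow_mul (by positivity), one_div, inv_mul_cancel₀ (by positivity), Real.rpow_one]
  have hτp : 0 < τ := by positivity
  have hτ : τ0 ≤ τ := by
    rw [div_le_iff₀ hn0, ← hτd] at hs
    exact le_of_pow_le_pow_left₀ hd0.ne' hτp.le hs
  have h1 := h τ hτ
  have h2 := card_isPrincipal_dvd_norm_le K J (τ ^ d)
  rw [aux2 K hτp, hτd, ← aux1 K hJ] at h2
  rw [← h2, hτd, Nat.cast_mul] at h1
  have hsq : s * n / √τ = s ^ (1 - 1 / (2 * d) : ℝ) * n ^ (1 - 1 / (2 * d) : ℝ) := by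
    rw [← Real.mul_rpow hs0.le hn0.le, Real.rpow_sub (by positivity), Real.rpow_one, Real.sqrt_eq_rpow, 
      ← Real.rpow_mul (by positivity)]
    congr 2
    field_simp
  rw [hsq] at h1
  rw [← mul_le_mul_iff_of_pos_right ht]
  have : ∀ N : ℝ, |N - c * n / t * s| * t = |N * t - c * (s * n)| := fun N => by
    rw [← abs_of_pos ht, ← abs_mul, abs_of_pos ht]; congr 1; field_simp
  rw [this]
  refine h1.trans (le_of_eq ?_)
  field_simp

/-- the number of nonzero ideals of norm at most `s` -/
noncomputable def idc (s : ℝ) : ℕ := Nat.card {I : (Ideal (𝓞 K))⁰ // absNorm (I : Ideal (𝓞 K)) ≤ s}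

theorem fin_le (s : ℝ) : Finite {I : (Ideal (𝓞 K))⁰ // (absNorm (I : Ideal (𝓞 K)) : ℝ) ≤ s} := by
  by_cases hs : 0 ≤ s
  · simp_rw [← Nat.le_floor_iff hs]
    exact (finite_setOfPred_absNorm_le₀ ⌊s⌋₊)
  · have : IsEmpty {I : (Ideal (𝓞 K))⁰ // (absNorm (I : Ideal (𝓞 K)) : ℝ) ≤ s} := 
      ⟨fun I => hs (le_trans (by positivity) I.2)⟩
    infer_instance

theorem idc_sum (s : ℝ) : idc K s = ∑ C : ClassGroup (𝓞 K), 
    Nat.card {I : (Ideal (𝓞 K))⁰ // absNorm (I : Ideal (𝓞 K)) ≤ s ∧ ClassGroup.mk0 I = C} := by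
  classical
  have := fin_le K s
  have : Fintype {I : (Ideal (𝓞 K))⁰ // absNorm (I : Ideal (𝓞 K)) ≤ s} := Fintype.ofFinite _
  let e := fun C : ClassGroup (𝓞 K) ↦ Equiv.subtypeSubtypeEquivSubtypeInter
    (fun I : (Ideal (𝓞 K))⁰ ↦ absNorm I.1 ≤ s) (fun I ↦ ClassGroup.mk0 I = C)
  simp_rw [idc, ← Nat.card_congr (e _), Nat.card_eq_fintype_card, Fintype.subtype_card]
  rw [Fintype.card, Finset.card_eq_sum_card_fiberwise (f := fun I ↦ ClassGroup.mk0 I.1)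
    (t := Finset.univ) (fun _ _ ↦ Finset.mem_univ _)]

theorem idc_mono {s t : ℝ} (h : s ≤ t) : idc K s ≤ idc K t := by
  have := fin_le K t
  exact Nat.card_le_card_of_injective (fun I => ⟨I.1, I.2.trans h⟩ : {I : (Ideal (𝓞 K))⁰ // absNorm (I : Ideal (𝓞 K)) ≤ s} → {I : (Ideal (𝓞 K))⁰ // absNorm (I : Ideal (𝓞 K)) ≤ t}) 
    (fun a b hab => Subtype.ext (by simpa using hab))

theorem idc_est : ∃ A κ δ : ℝ, 0 ≤ A ∧ 0 < κ ∧ 0 < δ ∧ δ < 1 ∧ ∀ s : ℝ, 1 ≤ s → 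
    |(idc K s : ℝ) - κ * s| ≤ A * s ^ (1 - δ) := by
  classical
  choose A c s0 hA hs0 h using count_class K
  set d := Module.finrank ℚ K with hd
  have hd0 : 0 < d := Module.finrank_pos
  have hd1 : (1:ℝ) ≤ d := by exact_mod_cast hd0
  set δ : ℝ := 1 / (2 * d) with hδ
  have hδ0 : 0 < δ := by positivity
  have hδ1 : δ < 1 := by rw [hδ, div_lt_one (by positivity)]; linarith
  set κ := ∑ C, c C
  set S := ∑ C, s0 C
  have hSC : ∀ C, s0 C ≤ S := fun C => Finset.single_le_sum (fun C _ => (hs0 C).le) (Finset.mem_univ C)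
  have hS0 : 0 < S := (hs0 1).trans_le (hSC 1)
  have hbig : ∀ s : ℝ, S ≤ s → |(idc K s : ℝ) - κ * s| ≤ (∑ C, A C) * s ^ (1 - δ) := by
    intro s hs
    rw [idc_sum, Nat.cast_sum, Finset.sum_mul, ← Finset.sum_sub_distrib, Finset.sum_mul]
    refine (Finset.abs_sum_le_sum_abs _ _).trans (Finset.sum_le_sum fun C _ => ?_)
    exact h C s ((hSC C).trans hs)
  have hκ : 0 < κ := by
    have h1 := Ideal.tendsto_norm_le_div_atTop₀ K
    have h2 : Tendsto (fun s : ℝ => (idc K s : ℝ) / s) atTop (𝓝 κ) := by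
      have h3 : Tendsto (fun s : ℝ => (∑ C, A C) * s ^ (-δ)) atTop (𝓝 0) := by
        simpa using (tendsto_rpow_neg_atTop hδ0).const_mul (∑ C, A C)
      rw [tendsto_iff_norm_sub_tendsto_zero]
      refine squeeze_zero' (Eventually.of_forall fun _ => norm_nonneg _) ?_ h3
      filter_upwards [eventually_ge_atTop S, eventually_gt_atTop 0] with s hs hs0
      have e : (idc K s : ℝ) / s - κ = ((idc K s : ℝ) - κ * s) / s := by field_simp
      rw [e, norm_div, Real.norm_eq_abs, Real.norm_of_nonneg hs0.le, div_le_iff₀ hs0]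
      refine (hbig s hs).trans (le_of_eq ?_)
      rw [mul_assoc, ← Real.rpow_add_one hs0.ne']
      congr 2; ring
    rw [tendsto_nhds_unique h2 h1]
    have := regulator_pos K
    have := Units.torsionOrder_pos K
    have : 0 < classNumber K := Fintype.card_pos
    have : 0 < |(discr K : ℝ)| := by
      rw [abs_pos]; exact_mod_cast discr_ne_zero K
    have h7 : 0 < √|(discr K : ℝ)| := Real.sqrt_pos.2 this
    positivity
  refine ⟨(∑ C, A C) + idc K S + κ * S, κ, δ, ?_, hκ, hδ0, hδ1, fun s hs => ?_⟩
  · have : 0 ≤ ∑ C, A C := Finset.sum_nonneg fun C _ => hA C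
    positivity
  · have hA0 : 0 ≤ ∑ C, A C := Finset.sum_nonneg fun C _ => hA C
    have hs1 : 1 ≤ s ^ (1 - δ) := Real.one_le_rpow hs (by linarith)
    rcases le_total S s with h | h
    · refine (hbig s h).trans ?_
      gcongr
      have : (0:ℝ) ≤ idc K S := by positivity
      nlinarith
    · have h1 : (idc K s : ℝ) ≤ idc K S := by exact_mod_cast idc_mono K h
      have h2 : κ * s ≤ κ * S := by gcongr
      have h3 : (0:ℝ) ≤ idc K s := by positivity
      have h4 : 0 ≤ κ * s := by positivity
      calc |(idc K s : ℝ) - κ * s| ≤ (∑ C, A C) + idc K S + κ * S := by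
            rw [abs_le]; constructor <;> linarith
        _ ≤ _ := le_mul_of_one_le_right (by linarith) hs1
end G4
end PIT
end

section
open MeasureTheory Filter Topology Set

namespace PIT
section W1
/-- Fejer kernel -/
noncomputable def kf (y : ℝ) : ℝ := 2 * (1 - Real.cos y) / y ^ 2

theorem kf_nonneg (y : ℝ) : 0 ≤ kf y := by
  have := Real.cos_le_one y
  unfold kf
  have : 0 ≤ 1 - Real.cos y := by linarith
  positivity

theorem kf_le (y : ℝ) : kf y ≤ 5 * (1 + y ^ 2)⁻¹ := by
  unfold kf
  rw [← div_eq_mul_inv]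
  by_cases hy : y = 0
  · simp [hy]
  have h1 := Real.neg_one_le_cos y
  have h2 := Real.one_sub_sq_div_two_le_cos (x := y)
  have : 0 < y ^ 2 := by positivity
  rw [div_le_div_iff₀ this (by positivity)]
  nlinarith

theorem kf_meas : Measurable kf := by unfold kf; fun_prop

theorem kf_int : Integrable kf := by
  refine Integrable.mono' (integrable_inv_one_add_sq.const_mul 5) kf_meas.aestronglyMeasurable 
    (Eventually.of_forall fun y => ?_)
  rw [Real.norm_of_nonneg (kf_nonneg y)]
  exact kf_le y

theorem kf_pos : 0 < ∫ y, kf y := by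
  rw [integral_pos_iff_support_of_nonneg kf_nonneg kf_int]
  have : Ioo (0:ℝ) 1 ⊆ Function.support kf := by
    intro y hy
    have h1 : Real.cos y < 1 := by
      rw [← Real.cos_zero]
      exact Real.cos_lt_cos_of_nonneg_of_le_pi le_rfl (by linarith [hy.2, Real.pi_gt_three]) hy.1
    have := hy.1
    have : 0 < 1 - Real.cos y := by linarith
    apply ne_of_gt
    unfold kf
    positivity
  refine lt_of_lt_of_le ?_ (measure_mono this)
  simp

theorem kf_fourier (y : ℝ) (hy : y ≠ 0) : 
    ∫ t in Icc (-1:ℝ) 1, ((1 - |t| : ℝ) : ℂ) * Complex.exp (Complex.I * (y * t)) = (kf y : ℂ) := by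
  rw [integral_Icc_eq_integral_Ioc, ← intervalIntegral.integral_of_le (by norm_num)]
  have hyc : (y : ℂ) ≠ 0 := by exact_mod_cast hy
  have hI : Complex.I * y ≠ 0 := mul_ne_zero Complex.I_ne_zero hyc
  have hcont : Continuous fun t : ℝ => ((1 - |t| : ℝ) : ℂ) * Complex.exp (Complex.I * (y * t)) := by
    fun_prop
  rw [← intervalIntegral.integral_add_adjacent_intervals (b := 0) (hcont.intervalIntegrable _ _) 
    (hcont.intervalIntegrable _ _)]
  have hd : ∀ σ : ℂ, ∀ t : ℝ, HasDerivAt (fun t : ℝ => ((1 + σ * t) / (Complex.I * y) - σ / (Complex.I * y) ^ 2) * 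
      Complex.exp (Complex.I * (y * t))) ((1 + σ * t) * Complex.exp (Complex.I * (y * t))) t := by
    intro σ t
    have h0 : HasDerivAt (fun t : ℝ => (t : ℂ)) 1 t := Complex.ofRealCLM.hasDerivAt
    have h1 : HasDerivAt (fun t : ℝ => (1 + σ * t) / (Complex.I * y) - σ / (Complex.I * y) ^ 2) 
        (σ * 1 / (Complex.I * y)) t := 
      (((h0.const_mul σ).const_add 1).div_const _).sub_const _
    have h2 : HasDerivAt (fun t : ℝ => Complex.exp (Complex.I * (y * t))) 
      (Complex.exp (Complex.I * (y * t)) * (Complex.I * (y * 1))) t := 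
      ((h0.const_mul (y:ℂ)).const_mul Complex.I).cexp
    refine (h1.mul h2).congr_deriv ?_
    field_simp
    ring
  have e1 : ∫ t in (-1:ℝ)..0, ((1 - |t| : ℝ) : ℂ) * Complex.exp (Complex.I * (y * t)) = 
      ∫ t in (-1:ℝ)..0, (1 + 1 * t) * Complex.exp (Complex.I * (y * t)) := by
    refine intervalIntegral.integral_congr fun t ht => ?_
    rw [uIcc_of_le (by norm_num)] at ht
    simp only [abs_of_nonpos ht.2]
    push_cast; ring
  have e2 : ∫ t in (0:ℝ)..1, ((1 - |t| : ℝ) : ℂ) * Complex.exp (Complex.I * (y * t)) = 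
      ∫ t in (0:ℝ)..1, (1 + (-1) * t) * Complex.exp (Complex.I * (y * t)) := by
    refine intervalIntegral.integral_congr fun t ht => ?_
    rw [uIcc_of_le (by norm_num)] at ht
    simp only [abs_of_nonneg ht.1]
    push_cast; ring
  rw [e1, e2, intervalIntegral.integral_eq_sub_of_hasDerivAt (fun t _ => hd 1 t) (by
      apply Continuous.intervalIntegrable; fun_prop), 
    intervalIntegral.integral_eq_sub_of_hasDerivAt (fun t _ => hd (-1) t) (by
      apply Continuous.intervalIntegrable; fun_prop)]
  have hc : (kf y : ℂ) = 2 * (1 - (Complex.exp (Complex.I * y) + Complex.exp (-(Complex.I * y))) / 2) / y ^ 2 := by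
    unfold kf
    push_cast
    rw [Complex.cos]
    ring_nf
  rw [hc]
  simp only [Complex.ofReal_neg, Complex.ofReal_one, Complex.ofReal_zero, mul_zero, Complex.exp_zero, mul_neg, mul_one]
  have hI2 : (Complex.I * (y:ℂ)) ^ 2 = - y ^ 2 := by rw [mul_pow, Complex.I_sq]; ring
  rw [hI2]
  field_simp
  ring
end W1
end PIT
end

section
open MeasureTheory Filter Topology Set

namespace PIT
section W2
variable {D : ℝ → ℝ} {N : ℝ} {H : ℂ → ℂ}

theorem exp_int {ε : ℝ} (hε : 0 < ε) : IntegrableOn (fun u : ℝ => Real.exp (-ε * u)) (Ioi 0) := 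
  integrableOn_exp_mul_Ioi (by linarith) 0

theorem W_fubini (hD : Measurable D) (hN : ∀ u, |D u| ≤ N) 
    (hH : ∀ z : ℂ, 0 < z.re → H z = ∫ u in Ioi (0:ℝ), (D u : ℂ) * Complex.exp (-z * u))
    {ε l : ℝ} (hε : 0 < ε) (hl : 0 < l) (v : ℝ) : 
    ∫ u in Ioi (0:ℝ), ((D u * Real.exp (-ε * u) * kf (l * (v - u)) : ℝ) : ℂ) = 
    ∫ t in Icc (-1:ℝ) 1, ((1 - |t| : ℝ) : ℂ) * Complex.exp (Complex.I * (l * v * t)) * H (ε + Complex.I * (l * t)) := by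
  have e1 : ∀ᵐ u ∂(volume.restrict (Ioi (0:ℝ))), ((D u * Real.exp (-ε * u) * kf (l * (v - u)) : ℝ) : ℂ) = 
      ∫ t in Icc (-1:ℝ) 1, ((1 - |t| : ℝ) : ℂ) * (((D u * Real.exp (-ε * u) : ℝ) : ℂ) * Complex.exp (Complex.I * (l * (v - u) * t))) := by
    have : ∀ᵐ u : ℝ ∂(volume.restrict (Ioi (0:ℝ))), u ≠ v := by
      apply ae_restrict_of_ae
      exact Measure.ae_ne volume v
    filter_upwards [this] with u hu
    have hy : l * (v - u) ≠ 0 := mul_ne_zero hl.ne' (sub_ne_zero.2 hu.symm)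
    rw [Complex.ofReal_mul, ← kf_fourier _ hy, ← integral_const_mul]
    congr 1; ext t
    push_cast
    ring
  rw [integral_congr_ae e1, integral_integral_swap]
  · refine setIntegral_congr_fun measurableSet_Icc fun t ht => ?_
    rw [hH _ (by simp [hε]), ← integral_const_mul]
    congr 1; ext u
    push_cast
    rw [show Complex.I * (l * (v - u) * t) = Complex.I * (l * v * t) + (- Complex.I * (l * t) * u) by ring,
      Complex.exp_add, show -(ε + Complex.I * (l * t)) * u = -ε * u + (- Complex.I * (l * t) * u) by ring, Complex.exp_add]
    ring
  · have h1 : Integrable (fun u : ℝ => ((D u * Real.exp (-ε * u) : ℝ) : ℂ)) (volume.restrict (Ioi 0)) := by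
      apply Integrable.ofReal
      refine Integrable.bdd_mul (c := N) (exp_int hε) hD.aestronglyMeasurable (Eventually.of_forall hN)
    have h2 : Integrable (fun t : ℝ => ((1 - |t| : ℝ) : ℂ)) (volume.restrict (Icc (-1) 1)) := 
      (Continuous.integrableOn_Icc (by fun_prop))
    have h3 := h1.mul_prod h2
    have h4 : Integrable (fun p : ℝ × ℝ => Complex.exp (Complex.I * (l * (v - p.1) * p.2)) * (((D p.1 * Real.exp (-ε * p.1) : ℝ) : ℂ) * ((1 - |p.2| : ℝ) : ℂ)))
        ((volume.restrict (Ioi 0)).prod (volume.restrict (Icc (-1) 1))) := by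
      refine Integrable.bdd_mul (c := 1) h3 (Continuous.aestronglyMeasurable (by fun_prop)) (Eventually.of_forall fun p => ?_)
      rw [show Complex.I * (l * (v - p.1) * p.2) = ((l * (v - p.1) * p.2 : ℝ) : ℂ) * Complex.I by push_cast; ring, 
        Complex.norm_exp_ofReal_mul_I]
    refine h4.congr (Eventually.of_forall fun p => ?_)
    simp only [Function.uncurry]
    ring

theorem kf_comp_int {l : ℝ} (hl : 0 < l) (v : ℝ) : Integrable fun u => kf (l * (v - u)) := by
  have h := kf_int.comp_mul_left' hl.ne'
  exact h.comp_sub_left v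

theorem W_lim (hD : Measurable D) (hN : ∀ u, |D u| ≤ N) 
    (hH : ∀ z : ℂ, 0 < z.re → H z = ∫ u in Ioi (0:ℝ), (D u : ℂ) * Complex.exp (-z * u))
    (hHc : ContinuousOn H {z | 0 ≤ z.re}) {l : ℝ} (hl : 0 < l) (v : ℝ) : 
    ∫ u in Ioi (0:ℝ), ((D u * kf (l * (v - u)) : ℝ) : ℂ) = 
    ∫ t in Icc (-1:ℝ) 1, ((1 - |t| : ℝ) : ℂ) * Complex.exp (Complex.I * (l * v * t)) * H (Complex.I * (l * t)) := by
  have hN0 : 0 ≤ N := (abs_nonneg _).trans (hN 0)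
  let F : Filter ℝ := 𝓝[Ioc 0 1] (0:ℝ)
  have hF : F = 𝓝[>] 0 := nhdsWithin_Ioc_eq_nhdsGT (by norm_num)
  have hFne : F.NeBot := by rw [hF]; infer_instance
  have t1 : Tendsto (fun ε : ℝ => ∫ u in Ioi (0:ℝ), ((D u * Real.exp (-ε * u) * kf (l * (v - u)) : ℝ) : ℂ)) F
      (𝓝 (∫ u in Ioi (0:ℝ), ((D u * kf (l * (v - u)) : ℝ) : ℂ))) := by
    refine tendsto_integral_filter_of_dominated_convergence (fun u => N * kf (l * (v - u))) ?_ ?_ ?_ ?_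
    · refine Eventually.of_forall fun ε => ?_
      apply Measurable.aestronglyMeasurable
      have := kf_meas
      fun_prop
    · filter_upwards [self_mem_nhdsWithin] with ε hε
      refine (ae_restrict_iff' measurableSet_Ioi).2 (Eventually.of_forall fun u hu => ?_)
      rw [Complex.norm_real, norm_mul, norm_mul, Real.norm_of_nonneg (kf_nonneg _), Real.norm_of_nonneg (Real.exp_pos _).le]
      refine mul_le_mul_of_nonneg_right ?_ (kf_nonneg _)
      have h1 : Real.exp (-ε * u) ≤ 1 := by
        rw [Real.exp_le_one_iff]
        have := mul_pos hε.1 hu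
        linarith
      calc _ ≤ N * 1 := by
            gcongr
            exact hN u
        _ = N := mul_one _
    · exact ((kf_comp_int hl v).const_mul N).integrableOn
    · refine Eventually.of_forall fun u => ?_
      have : Continuous fun ε : ℝ => ((D u * Real.exp (-ε * u) * kf (l * (v - u)) : ℝ) : ℂ) := by fun_prop
      have h := (this.tendsto 0).mono_left (nhdsWithin_le_nhds (s := Ioc 0 1))
      simpa [F] using h
  have t2 : Tendsto (fun ε : ℝ => ∫ t in Icc (-1:ℝ) 1, ((1 - |t| : ℝ) : ℂ) * Complex.exp (Complex.I * (l * v * t)) * H (ε + Complex.I * (l * t))) F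
      (𝓝 (∫ t in Icc (-1:ℝ) 1, ((1 - |t| : ℝ) : ℂ) * Complex.exp (Complex.I * (l * v * t)) * H (Complex.I * (l * t)))) := by
    let Q : Set (ℝ × ℝ) := Icc 0 1 ×ˢ Icc (-1) 1
    let G : ℝ × ℝ → ℂ := fun p => ((1 - |p.2| : ℝ) : ℂ) * Complex.exp (Complex.I * (l * v * p.2)) * H (p.1 + Complex.I * (l * p.2))
    have hG : ContinuousOn G Q := by
      refine ContinuousOn.mul (Continuous.continuousOn (by fun_prop)) (hHc.comp (Continuous.continuousOn (by fun_prop)) ?_)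
      intro p hp
      simpa using hp.1.1
    have hQ : IsCompact Q := isCompact_Icc.prod isCompact_Icc
    obtain ⟨C, hC⟩ := hQ.exists_bound_of_continuousOn hG
    refine tendsto_integral_filter_of_dominated_convergence (fun _ => C) ?_ ?_ ?_ ?_
    · filter_upwards [self_mem_nhdsWithin] with ε hε
      apply ContinuousOn.aestronglyMeasurable _ measurableSet_Icc
      have : ContinuousOn (fun t : ℝ => G (ε, t)) (Icc (-1) 1) := by
        refine hG.comp (by fun_prop) fun t ht => ?_
        exact ⟨⟨hε.1.le, hε.2⟩, ht⟩
      exact this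
    · filter_upwards [self_mem_nhdsWithin] with ε hε
      refine (ae_restrict_iff' measurableSet_Icc).2 (Eventually.of_forall fun t ht => ?_)
      exact hC (ε, t) ⟨⟨hε.1.le, hε.2⟩, ht⟩
    · exact integrable_const C
    · refine (ae_restrict_iff' measurableSet_Icc).2 (Eventually.of_forall fun t ht => ?_)
      have h1 : Tendsto (fun ε : ℝ => ((ε, t) : ℝ × ℝ)) F (𝓝[Q] ((0:ℝ), t)) := by
        rw [tendsto_nhdsWithin_iff]
        constructor
        · exact ((by fun_prop : Continuous fun ε : ℝ => ((ε, t) : ℝ × ℝ)).tendsto 0).mono_left nhdsWithin_le_nhds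
        · filter_upwards [self_mem_nhdsWithin] with ε hε
          exact ⟨⟨hε.1.le, hε.2⟩, ht⟩
      have h2 := (hG (0, t) ⟨⟨le_rfl, zero_le_one⟩, ht⟩).tendsto.comp h1
      simpa [G, Function.comp_def] using h2
  refine tendsto_nhds_unique t1 (t2.congr' ?_)
  filter_upwards [self_mem_nhdsWithin] with ε hε
  exact (W_fubini hD hN hH hε.1 hl v).symm

theorem W_RL (hD : Measurable D) (hN : ∀ u, |D u| ≤ N) 
    (hH : ∀ z : ℂ, 0 < z.re → H z = ∫ u in Ioi (0:ℝ), (D u : ℂ) * Complex.exp (-z * u))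
    (hHc : ContinuousOn H {z | 0 ≤ z.re}) {l : ℝ} (hl : 0 < l) : 
    Tendsto (fun v => ∫ u in Ioi (0:ℝ), D u * kf (l * (v - u))) atTop (𝓝 0) := by
  let g : ℝ → ℂ := (Icc (-1:ℝ) 1).indicator fun t => ((1 - |t| : ℝ) : ℂ) * H (Complex.I * (l * t))
  have h1 := Real.tendsto_integral_exp_smul_cocompact g
  have h2 : Tendsto (fun v : ℝ => -(l * v / (2 * Real.pi))) atTop (cocompact ℝ) := by
    have : Tendsto (fun v : ℝ => -(l * v / (2 * Real.pi))) atTop atBot := by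
      apply tendsto_neg_atTop_atBot.comp
      exact (tendsto_id.const_mul_atTop hl).atTop_div_const (by positivity)
    exact this.mono_right atBot_le_cocompact
  have h3 := h1.comp h2
  have h4 : Tendsto (fun v => ((∫ u in Ioi (0:ℝ), D u * kf (l * (v - u)) : ℝ) : ℂ)) atTop (𝓝 0) := by
    refine h3.congr fun v => ?_
    rw [← integral_complex_ofReal]
    have h5 := W_lim hD hN hH hHc hl v
    rw [h5, ← integral_indicator measurableSet_Icc]
    simp only [Function.comp_apply]
    congr 1; ext t
    simp only [g, Set.indicator]
    split_ifs
    · rw [Circle.smul_def, Real.fourierChar_apply, smul_eq_mul]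
      have : Complex.exp (Complex.I * (l * v * t)) = Complex.exp (((2 * Real.pi * (-(t * -(l * v / (2 * Real.pi)))) : ℝ) : ℂ) * Complex.I) := by
        congr 1
        have : (2 * Real.pi * (-(t * -(l * v / (2 * Real.pi)))) : ℝ) = l * v * t := by
          field_simp
        rw [this]; push_cast; ring
      rw [this]; ring
    · simp
  have h6 := (Complex.continuous_re.tendsto 0).comp h4
  simpa [Function.comp_def] using h6
end W2
end PIT
end

section
open MeasureTheory Filter Topology Set

namespace PIT
section W3

theorem W_cv (b : ℝ → ℝ) (hb : ∀ u ≤ 0, b u = 0) {l : ℝ} (hl : 0 < l) (v : ℝ) : 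
    l * ∫ u in Ioi (0:ℝ), b u * kf (l * (v - u)) = ∫ y, b (v - y / l) * kf y := by
  have h1 : ∫ u in Ioi (0:ℝ), b u * kf (l * (v - u)) = ∫ u, b u * kf (l * (v - u)) := by
    apply setIntegral_eq_integral_of_forall_compl_eq_zero
    intro u hu
    rw [hb u (by simpa using hu), zero_mul]
  have h2 := Measure.integral_comp_div (fun w => b (v - w) * kf (l * w)) l
  have h3 := integral_sub_left_eq_self (fun u => b u * kf (l * (v - u))) volume v
  rw [h1, ← h3]
  simp only [sub_sub_cancel]
  rw [abs_of_pos hl, smul_eq_mul] at h2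
  rw [← h2]
  congr 1; ext y
  rw [mul_div_cancel₀ _ hl.ne']

theorem W_mulint {b : ℝ → ℝ} {M : ℝ} (hb : Measurable b) (hM : ∀ u, |b u| ≤ M) {f : ℝ → ℝ} 
    {μ : Measure ℝ} (hf : Integrable f μ) : Integrable (fun u => b u * f u) μ :=
  Integrable.bdd_mul (c := M) hf hb.aestronglyMeasurable (Eventually.of_forall hM)

variable {B : ℝ → ℝ} {M A : ℝ} {H : ℂ → ℂ}

theorem W_conv (hBm : Measurable B) (hB : ∀ u, 0 ≤ B u) (hM : ∀ u, B u ≤ M) (hB0 : ∀ u ≤ 0, B u = 0) 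
    (hH : ∀ z : ℂ, 0 < z.re → H z = (∫ u in Ioi (0:ℝ), (B u : ℂ) * Complex.exp (-z * u)) - A / z)
    (hHc : ContinuousOn H {z | 0 ≤ z.re}) {l : ℝ} (hl : 0 < l) :
    Tendsto (fun v => ∫ y, B (v - y / l) * kf y) atTop (𝓝 (A * ∫ y, kf y)) := by
  have hBM : ∀ u, |B u| ≤ M := fun u => by rw [abs_of_nonneg (hB u)]; exact hM u
  have hH' : ∀ z : ℂ, 0 < z.re → H z = ∫ u in Ioi (0:ℝ), ((B u - A : ℝ) : ℂ) * Complex.exp (-z * u) := by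
    intro z hz
    have hz0 : z ≠ 0 := by rintro rfl; simp at hz
    have e1 : IntegrableOn (fun u : ℝ => Complex.exp (-z * u)) (Ioi 0) := 
      integrableOn_exp_mul_complex_Ioi (by simpa using hz) 0
    have e2 : ∫ u in Ioi (0:ℝ), Complex.exp (-z * u) = 1 / z := by
      rw [integral_exp_mul_complex_Ioi (by simpa using hz) 0]
      simp [neg_div_neg_eq]
    have e3 : IntegrableOn (fun u : ℝ => (B u : ℂ) * Complex.exp (-z * u)) (Ioi 0) := by
      refine Integrable.bdd_mul (c := M) e1 (by fun_prop) (Eventually.of_forall fun u => ?_)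
      rw [Complex.norm_real]; exact hBM u
    rw [hH z hz]
    simp_rw [Complex.ofReal_sub, sub_mul]
    rw [integral_sub e3 (e1.const_mul _), integral_const_mul, e2, mul_one_div]
  have h1 := W_RL (D := fun u => B u - A) (N := M + |A|) (hBm.sub_const A) (fun u => 
    (abs_sub _ _).trans (by gcongr; exact hBM u)) hH' hHc hl
  let b : ℝ → ℝ := (Ioi 0).indicator fun _ => 1
  have hbm : Measurable b := measurable_const.indicator measurableSet_Ioi
  have hb0 : ∀ u ≤ 0, b u = 0 := fun u hu => by simp [b, hu]
  have hb1 : ∀ u, |b u| ≤ 1 := fun u => by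
    simp only [b, Set.indicator]; split_ifs <;> simp
  have e4 : ∀ v, l * ∫ u in Ioi (0:ℝ), (B u - A) * kf (l * (v - u)) = 
      (∫ y, B (v - y / l) * kf y) - A * ∫ y, b (v - y / l) * kf y := by
    intro v
    have hk := (kf_comp_int hl v).integrableOn (s := Ioi 0)
    rw [← W_cv B hB0 hl, ← W_cv b hb0 hl]
    simp_rw [sub_mul]
    rw [integral_sub (W_mulint hBm hBM hk) (hk.const_mul A), integral_const_mul]
    have : ∫ u in Ioi (0:ℝ), b u * kf (l * (v - u)) = ∫ u in Ioi (0:ℝ), kf (l * (v - u)) := by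
      refine setIntegral_congr_fun measurableSet_Ioi fun u hu => ?_
      simp only [b, Set.indicator_of_mem hu, one_mul]
    rw [this]; ring
  have h2 : Tendsto (fun v => ∫ y, b (v - y / l) * kf y) atTop (𝓝 (∫ y, kf y)) := by
    refine tendsto_integral_filter_of_dominated_convergence kf ?_ ?_ kf_int ?_
    · refine Eventually.of_forall fun v => Measurable.aestronglyMeasurable ?_
      have := kf_meas
      fun_prop
    · refine Eventually.of_forall fun v => Eventually.of_forall fun y => ?_
      rw [norm_mul, Real.norm_of_nonneg (kf_nonneg y)]
      exact mul_le_of_le_one_left (kf_nonneg y) (hb1 _)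
    · refine Eventually.of_forall fun y => tendsto_const_nhds.congr' ?_
      filter_upwards [eventually_gt_atTop (y / l)] with v hv
      have : v - y / l ∈ Ioi (0:ℝ) := by simpa using hv
      simp only [b, Set.indicator_of_mem this, one_mul]
  have h3 := (h1.const_mul l).add (h2.const_mul A)
  simp_rw [e4] at h3
  simpa using h3

theorem tauber (hBm : Measurable B) (hB : ∀ u, 0 ≤ B u) (hM : ∀ u, B u ≤ M) (hB0 : ∀ u ≤ 0, B u = 0) 
    (hmono : Monotone fun u => B u * Real.exp u)
    (hH : ∀ z : ℂ, 0 < z.re → H z = (∫ u in Ioi (0:ℝ), (B u : ℂ) * Complex.exp (-z * u)) - A / z)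
    (hHc : ContinuousOn H {z | 0 ≤ z.re}) :
    Tendsto B atTop (𝓝 A) := by
  have hBM : ∀ u, |B u| ≤ M := fun u => by rw [abs_of_nonneg (hB u)]; exact hM u
  have hM0 : 0 ≤ M := (hB 0).trans (hM 0)
  set I := ∫ y, kf y with hI
  have hIp : 0 < I := kf_pos
  have hstep : ∀ u u' : ℝ, u ≤ u' → B u ≤ B u' * Real.exp (u' - u) := by
    intro u u' h
    have h1 : B u * Real.exp u ≤ B u' * Real.exp u' := hmono h
    rw [Real.exp_sub, ← mul_div_assoc, le_div_iff₀ (Real.exp_pos _)]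
    exact h1
  have hint : ∀ (l v : ℝ), Integrable fun y => B (v - y / l) * kf y := fun l v =>
    W_mulint (b := fun y => B (v - y / l)) (by fun_prop) (fun y => hBM _) kf_int
  let J : ℝ → ℝ := fun Y => ∫ y in Icc (-Y) Y, kf y
  have hJle : ∀ Y, J Y ≤ I := fun Y => setIntegral_le_integral kf_int (Eventually.of_forall kf_nonneg)
  have hJ : Tendsto J atTop (𝓝 I) := by
    have h1 := intervalIntegral_tendsto_integral (μ := volume) (f := kf) kf_int tendsto_neg_atTop_atBot tendsto_id
    refine h1.congr' ?_
    filter_upwards [eventually_ge_atTop 0] with Y hY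
    simp only [J, id]
    rw [integral_Icc_eq_integral_Ioc, intervalIntegral.integral_of_le (by linarith)]
  have hy : ∀ {Y l y : ℝ}, 0 < l → y ∈ Icc (-Y) Y → -(Y / l) ≤ y / l ∧ y / l ≤ Y / l := by
    intro Y l y hl hy
    rw [← neg_div]
    exact ⟨by gcongr; exact hy.1, by gcongr; exact hy.2⟩
  have hup : ∀ Y l v : ℝ, 0 < l → B v * Real.exp (-(2 * (Y / l))) * J Y ≤ ∫ y, B (v + Y / l - y / l) * kf y := by
    intro Y l v hl
    refine le_trans ?_ (setIntegral_le_integral (s := Icc (-Y) Y) (hint l _) 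
      (Eventually.of_forall fun y => mul_nonneg (hB _) (kf_nonneg _)))
    rw [← integral_const_mul]
    refine setIntegral_mono_on (kf_int.integrableOn.const_mul _) (hint l _).integrableOn measurableSet_Icc fun y hyY => ?_
    refine mul_le_mul_of_nonneg_right ?_ (kf_nonneg _)
    obtain ⟨h1, h2⟩ := hy hl hyY
    have h3 := hstep v (v + Y / l - y / l) (by linarith)
    rw [Real.exp_neg, ← div_eq_mul_inv, div_le_iff₀ (Real.exp_pos _)]
    refine h3.trans ?_
    gcongr
    · exact hB _
    · linarith
  have hlow : ∀ Y l v : ℝ, 0 < l → ∫ y, B (v - Y / l - y / l) * kf y ≤ B v * Real.exp (2 * (Y / l)) * I + M * (I - J Y) := by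
    intro Y l v hl
    rw [← integral_add_compl (s := Icc (-Y) Y) measurableSet_Icc (hint l _)]
    have hcompl : I - J Y = ∫ y in (Icc (-Y) Y)ᶜ, kf y := by
      rw [hI, ← integral_add_compl (s := Icc (-Y) Y) measurableSet_Icc kf_int]; simp [J]
    refine add_le_add ?_ ?_
    · calc _ ≤ ∫ y in Icc (-Y) Y, (B v * Real.exp (2 * (Y / l))) * kf y := by
            refine setIntegral_mono_on (hint l _).integrableOn (kf_int.integrableOn.const_mul _) measurableSet_Icc fun y hyY => ?_
            refine mul_le_mul_of_nonneg_right ?_ (kf_nonneg _)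
            obtain ⟨h1, h2⟩ := hy hl hyY
            have h3 := hstep (v - Y / l - y / l) v (by linarith)
            refine h3.trans ?_
            gcongr
            · exact hB _
            · linarith
        _ = B v * Real.exp (2 * (Y / l)) * J Y := integral_const_mul _ _
        _ ≤ _ := by
            gcongr
            · exact mul_nonneg (hB _) (Real.exp_pos _).le
            · exact hJle Y
    · rw [hcompl, ← integral_const_mul]
      refine integral_mono (hint l _).integrableOn (kf_int.integrableOn.const_mul _) fun y => ?_
      exact mul_le_mul_of_nonneg_right (hM _) (kf_nonneg _)
  have hcv := fun {l : ℝ} (hl : 0 < l) => W_conv hBm hB hM hB0 hH hHc hl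
  have hexp : ∀ Y : ℝ, Tendsto (fun l : ℝ => Real.exp (2 * (Y / l))) atTop (𝓝 1) := by
    intro Y
    have h1 : Tendsto (fun l : ℝ => 2 * (Y / l)) atTop (𝓝 (2 * 0)) := (tendsto_const_nhds.div_atTop tendsto_id).const_mul 2
    have h2 := (Real.continuous_exp.tendsto _).comp h1
    simpa [Function.comp_def] using h2
  rw [tendsto_order]
  constructor
  · intro c hc
    have h1 : Tendsto (fun Y => (A * I - M * (I - J Y)) / I) atTop (𝓝 ((A * I - M * (I - I)) / I)) := by
      exact ((tendsto_const_nhds.sub ((tendsto_const_nhds.sub hJ).const_mul M)).div_const I)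
    have h2 : (A * I - M * (I - I)) / I = A := by field_simp; ring
    rw [h2] at h1
    obtain ⟨Y, hY⟩ := (h1.eventually (lt_mem_nhds hc)).exists
    have h3 : Tendsto (fun l : ℝ => (A * I - M * (I - J Y)) / I / Real.exp (2 * (Y / l))) atTop (𝓝 ((A * I - M * (I - J Y)) / I / 1)) :=
      tendsto_const_nhds.div (hexp Y) one_ne_zero
    rw [div_one] at h3
    obtain ⟨l, hl, hl0⟩ := ((h3.eventually (lt_mem_nhds hY)).and (eventually_gt_atTop 0)).exists
    have h4 : Tendsto (fun v : ℝ => v - Y / l) atTop atTop := tendsto_atTop_add_const_right _ _ tendsto_id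
    have h5 := (hcv hl0).comp h4
    have h6 := ((h5.sub_const (M * (I - J Y))).div_const I).div_const (Real.exp (2 * (Y / l)))
    filter_upwards [h6.eventually (lt_mem_nhds hl)] with v hv
    refine hv.trans_le ?_
    have h7 := hlow Y l v hl0
    rw [div_le_iff₀ (Real.exp_pos _), div_le_iff₀ hIp]
    simp only [Function.comp_apply]
    linarith
  · intro c hc
    have h1 : Tendsto (fun Y => A * I / J Y) atTop (𝓝 (A * I / I)) := tendsto_const_nhds.div hJ hIp.ne'
    rw [mul_div_cancel_right₀ _ hIp.ne'] at h1
    obtain ⟨Y, hY, hYp⟩ := ((h1.eventually (gt_mem_nhds hc)).and (hJ.eventually (lt_mem_nhds hIp))).exists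
    have h3 : Tendsto (fun l : ℝ => A * I / J Y * Real.exp (2 * (Y / l))) atTop (𝓝 (A * I / J Y * 1)) :=
      tendsto_const_nhds.mul (hexp Y)
    rw [mul_one] at h3
    obtain ⟨l, hl, hl0⟩ := ((h3.eventually (gt_mem_nhds hY)).and (eventually_gt_atTop 0)).exists
    have h4 : Tendsto (fun v : ℝ => v + Y / l) atTop atTop := tendsto_atTop_add_const_right _ _ tendsto_id
    have h5 := (hcv hl0).comp h4
    have h6 := (h5.div_const (J Y)).mul_const (Real.exp (2 * (Y / l)))
    filter_upwards [h6.eventually (gt_mem_nhds hl)] with v hv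
    refine lt_of_le_of_lt ?_ hv
    have h7 := hup Y l v hl0
    rw [Real.exp_neg] at h7
    have h8 : 0 < Real.exp (2 * (Y / l)) := Real.exp_pos _
    simp only [Function.comp_apply]
    rw [← div_le_iff₀ h8, le_div_iff₀ hYp]
    exact h7
end W3
end PIT
end

section
open MeasureTheory Filter Topology Set

namespace PIT
section W4

theorem wiener_ikehara {c : ℕ → ℝ} (hc : ∀ n, 0 ≤ c n) (hc1 : c 1 = 0) {M A : ℝ} (hM0 : 0 ≤ M)
    (hM : ∀ n : ℕ, ∑ k ∈ Finset.Icc 1 n, c k ≤ M * n) {g : ℂ → ℂ}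
    (hg : ContinuousOn g {z | 0 ≤ z.re})
    (hF : ∀ s : ℂ, 1 < s.re → LSeries (fun n => (c n : ℂ)) s = A / (s - 1) + g (s - 1)) :
    Tendsto (fun x : ℝ => (∑ k ∈ Finset.Icc 1 ⌊x⌋₊, c k) / x) atTop (𝓝 A) := by
  set ψ : ℝ → ℝ := fun x => ∑ k ∈ Finset.Icc 1 ⌊x⌋₊, c k with hψ
  have hψm : Monotone ψ := by
    intro x y hxy
    apply Finset.sum_le_sum_of_subset_of_nonneg
    · exact Finset.Icc_subset_Icc_right (Nat.floor_mono hxy)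
    · intro i _ _; exact hc i
  have hψ0 : ∀ x, 0 ≤ ψ x := fun x => Finset.sum_nonneg fun i _ => hc i
  have hψM : ∀ x, 0 ≤ x → ψ x ≤ M * x := fun x hx =>
    (hM _).trans (mul_le_mul_of_nonneg_left (Nat.floor_le hx) hM0)
  set B : ℝ → ℝ := fun u => ψ (Real.exp u) * Real.exp (-u) with hBd
  have hBe : ∀ u, B u * Real.exp u = ψ (Real.exp u) := by
    intro u
    simp only [hBd]
    rw [mul_assoc, ← Real.exp_add]; simp
  have key : Tendsto B atTop (𝓝 A) := by
    refine tauber (M := M) (H := fun z => (g z - A) / (1 + z)) ?_ ?_ ?_ ?_ ?_ ?_ ?_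
    · exact (hψm.measurable.comp Real.measurable_exp).mul (Real.measurable_exp.comp measurable_neg)
    · intro u; exact mul_nonneg (hψ0 _) (Real.exp_pos _).le
    · intro u
      have := hψM (Real.exp u) (Real.exp_pos _).le
      rw [← hBe] at this
      exact le_of_mul_le_mul_right this (Real.exp_pos u)
    · intro u hu
      have h1 : Real.exp u ≤ 1 := by simpa using hu
      have h2 : ψ (Real.exp u) ≤ ψ 1 := hψm h1
      have h3 : ψ 1 = 0 := by simp [hψ, hc1]
      have h4 : ψ (Real.exp u) = 0 := le_antisymm (h3 ▸ h2) (hψ0 _)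
      simp only [hBd]; rw [h4, zero_mul]
    · intro u v huv
      simp only [hBe]
      exact hψm (Real.exp_le_exp.2 huv)
    · intro z hz
      have hs : (1:ℝ) < (1 + z).re := by simpa using hz
      have hz0 : z ≠ 0 := by rintro rfl; simp at hz
      have hz1 : 1 + z ≠ 0 := by intro h; rw [h] at hs; norm_num at hs
      have e1 := LSeries_eq_mul_integral_of_nonneg c (r := 1) zero_le_one hs (by
        apply Asymptotics.IsBigO.of_bound M
        filter_upwards with n
        simp only [Real.rpow_one]
        rw [Real.norm_of_nonneg (Finset.sum_nonneg fun i _ => hc i),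
          Real.norm_of_nonneg (Nat.cast_nonneg n)]
        exact hM n) hc
      have e2 := hF (1 + z) hs
      have him : Real.exp '' (Ioi 0) = Ioi 1 := by
        ext x; constructor
        · rintro ⟨u, hu, rfl⟩; simpa using hu
        · intro hx
          have hx' : (1:ℝ) < x := hx
          exact ⟨Real.log x, Real.log_pos hx', Real.exp_log (by linarith)⟩
      have e3 := integral_image_eq_integral_abs_deriv_smul (f := Real.exp) (f' := Real.exp)
        (measurableSet_Ioi (a := (0:ℝ))) (fun x _ => (Real.hasDerivAt_exp x).hasDerivWithinAt)
        Real.exp_injective.injOn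
        (fun t : ℝ => (∑ k ∈ Finset.Icc 1 ⌊t⌋₊, (c k : ℂ)) * (t : ℂ) ^ (-((1 + z) + 1)))
      rw [him] at e3
      rw [e3] at e1
      have e4 : ∫ u in Ioi (0:ℝ), |Real.exp u| • ((∑ k ∈ Finset.Icc 1 ⌊Real.exp u⌋₊, (c k : ℂ)) *
          ((Real.exp u : ℝ) : ℂ) ^ (-((1 + z) + 1))) =
          ∫ u in Ioi (0:ℝ), (B u : ℂ) * Complex.exp (-z * u) := by
        congr 1; ext u
        rw [abs_of_pos (Real.exp_pos u)]
        simp only [hBd, hψ]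
        rw [Complex.real_smul, Complex.cpow_def_of_ne_zero (by exact_mod_cast (Real.exp_pos u).ne'),
          ← Complex.ofReal_log (Real.exp_pos u).le, Real.log_exp]
        push_cast
        rw [mul_left_comm, ← Complex.exp_add, mul_assoc, ← Complex.exp_add]
        congr 2; ring
      rw [e4, e2] at e1
      have e5 : (∫ u in Ioi (0:ℝ), (B u : ℂ) * Complex.exp (-z * u)) = (A / z + g z) / (1 + z) := by
        rw [eq_div_iff hz1, mul_comm, ← e1]; simp
      rw [e5]
      field_simp
      ring
    · apply ContinuousOn.div (hg.sub continuousOn_const) (by fun_prop)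
      intro z hz h
      have : (1 + z).re = 0 := by rw [h]; simp
      simp at this
      have hz' : 0 ≤ z.re := hz
      linarith
  refine (key.comp Real.tendsto_log_atTop).congr' ?_
  filter_upwards [eventually_gt_atTop 0] with x hx
  simp only [Function.comp, hBd]
  rw [Real.exp_neg, Real.exp_log hx, div_eq_mul_inv]

end W4
end PIT
end

section
open MeasureTheory Filter Topology Set

namespace PIT
section Z1

/-- continuation of an L-series with linear partial sums with power saving -/
theorem zeta_cont {a : ℕ → ℝ} (ha : ∀ n, 0 ≤ a n) {A κ δ : ℝ} (hA : 0 ≤ A) (hδ : 0 < δ) (hδ1 : δ < 1)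
    (hκ : 0 < κ)
    (hS : ∀ t : ℝ, 1 ≤ t → |(∑ k ∈ Finset.Icc 1 ⌊t⌋₊, a k) - κ * t| ≤ A * t ^ (1 - δ)) :
    ∃ Z : ℂ → ℂ, DifferentiableOn ℂ Z {s | 1 - δ < s.re} ∧ Z 1 ≠ 0 ∧
      ∀ s : ℂ, 1 < s.re → LSeriesSummable (fun n => (a n : ℂ)) s ∧
        Z s = (s - 1) * LSeries (fun n => (a n : ℂ)) s := by
  set S : ℝ → ℝ := fun x => ∑ k ∈ Finset.Icc 1 ⌊x⌋₊, a k with hSd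
  have hSm : Monotone S := by
    intro x y hxy
    apply Finset.sum_le_sum_of_subset_of_nonneg
    · exact Finset.Icc_subset_Icc_right (Nat.floor_mono hxy)
    · intro i _ _; exact ha i
  set E : ℝ → ℂ := fun t => ((S t - κ * t : ℝ) : ℂ) with hE
  have hEm : Measurable E := by
    apply Complex.measurable_ofReal.comp
    exact hSm.measurable.sub (by fun_prop)
  set E1 : ℝ → ℂ := (Ioi (1:ℝ)).indicator E with hE1
  have hE1m : Measurable E1 := hEm.indicator measurableSet_Ioi
  have hEb : ∀ t, 1 ≤ t → ‖E t‖ ≤ A * t ^ (1 - δ) := by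
    intro t ht
    simp only [hE]
    rw [Complex.norm_real]
    exact hS t ht
  have hE1b : ∀ t, 0 ≤ t → ‖E1 t‖ ≤ A * t ^ (1 - δ) := by
    intro t ht
    by_cases h : t ∈ Ioi (1:ℝ)
    · rw [hE1, indicator_of_mem h]; exact hEb t (le_of_lt h)
    · rw [hE1, indicator_of_notMem h, norm_zero]; positivity
  have hloc : LocallyIntegrableOn E1 (Ioi 0) := by
    have hc : LocallyIntegrable (fun t : ℝ => A * t ^ (1 - δ)) :=
      (continuous_const.mul (Real.continuous_rpow_const (by linarith))).locallyIntegrable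
    apply (hc.locallyIntegrableOn (Ioi 0)).mono hE1m.aestronglyMeasurable
    filter_upwards with t
    by_cases ht : 0 ≤ t
    · exact (hE1b t ht).trans (le_abs_self _)
    · have : t ∉ Ioi (1:ℝ) := by simp; linarith
      rw [hE1, indicator_of_notMem this, norm_zero]; exact norm_nonneg _
  have hmel : ∀ s : ℂ, 1 - δ < s.re → DifferentiableAt ℂ (fun s => mellin E1 (-s)) s := by
    intro s hs
    have : DifferentiableAt ℂ (mellin E1) (-s) := by
      refine mellin_differentiableAt_of_isBigO_rpow (a := δ - 1) (b := -s.re - 1) hloc ?_ ?_ ?_ ?_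
      · apply Asymptotics.IsBigO.of_bound A
        filter_upwards [eventually_ge_atTop 0] with t ht
        rw [neg_sub, Real.norm_of_nonneg (Real.rpow_nonneg ht _)]
        exact hE1b t ht
      · simp; linarith
      · apply Asymptotics.IsBigO.of_bound 1
        have : Iio (1:ℝ) ∈ 𝓝[>] (0:ℝ) := mem_nhdsWithin_of_mem_nhds (Iio_mem_nhds one_pos)
        filter_upwards [this] with t ht
        have : t ∉ Ioi (1:ℝ) := by
          have := mem_Iio.1 ht
          simp; linarith
        rw [hE1, indicator_of_notMem this, norm_zero]; positivity
      · simp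
    exact this.comp s differentiableAt_id.neg
  refine ⟨fun s => κ * s + s * (s - 1) * mellin E1 (-s), ?_, ?_, ?_⟩
  · intro s hs
    apply DifferentiableAt.differentiableWithinAt
    have := hmel s hs
    fun_prop
  · simp [hκ.ne']
  · intro s hs
    have hSb : ∀ t, 1 ≤ t → |S t| ≤ (κ + A) * t := by
      intro t ht
      have h1 := hS t ht
      have h2 : t ^ (1 - δ) ≤ t := by
        conv_rhs => rw [← Real.rpow_one t]
        exact Real.rpow_le_rpow_of_exponent_le ht (by linarith)
      have h3 : S t = (S t - κ * t) + κ * t := by ring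
      rw [h3]
      refine (abs_add_le _ _).trans ?_
      rw [abs_of_nonneg (by positivity : 0 ≤ κ * t)]
      have := mul_le_mul_of_nonneg_left h2 hA
      have h1' : |S t - κ * t| ≤ A * t ^ (1 - δ) := h1
      linarith
    have hO : (fun n ↦ ∑ k ∈ Finset.Icc 1 n, a k) =O[atTop] fun n ↦ (n : ℝ) ^ (1:ℝ) := by
      apply Asymptotics.IsBigO.of_bound (κ + A)
      filter_upwards [eventually_ge_atTop 1] with n hn
      have := hSb n (by exact_mod_cast hn)
      simp only [hSd, Nat.floor_natCast] at this
      rw [Real.rpow_one, Real.norm_of_nonneg (Nat.cast_nonneg n)]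
      exact this
    refine ⟨LSeriesSummable_of_sum_norm_bigO_and_nonneg hO ha zero_le_one hs, ?_⟩
    have e1 := LSeries_eq_mul_integral_of_nonneg a (r := 1) zero_le_one hs hO ha
    have hs1 : s - 1 ≠ 0 := by
      intro h
      have : (s - 1).re = 0 := by rw [h]; simp
      simp at this; linarith
    have e2 : mellin E1 (-s) = ∫ t in Ioi (1:ℝ), E t * (t:ℂ) ^ (-(s + 1)) := by
      unfold mellin
      have : ∀ t : ℝ, (t : ℂ) ^ (-s - 1) • E1 t =
          (Ioi (1:ℝ)).indicator (fun t : ℝ => E t * (t:ℂ) ^ (-(s + 1))) t := by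
        intro t
        by_cases h : t ∈ Ioi (1:ℝ)
        · rw [hE1, indicator_of_mem h, indicator_of_mem h, smul_eq_mul, mul_comm, show -s - 1 = -(s + 1) by ring]
        · rw [hE1, indicator_of_notMem h, indicator_of_notMem h, smul_zero]
      simp only [this]
      rw [setIntegral_indicator measurableSet_Ioi]
      congr 2
      ext x; simp; try (intro h)
    have i1 : IntegrableOn (fun t : ℝ => (κ : ℂ) * (t:ℂ) ^ (-s)) (Ioi 1) :=
      (integrableOn_Ioi_cpow_of_lt (by simp; linarith) one_pos).const_mul _
    have i2 : IntegrableOn (fun t : ℝ => E t * (t:ℂ) ^ (-(s + 1))) (Ioi 1) := by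
      have hb : IntegrableOn (fun t : ℝ => A * t ^ (-s.re - δ)) (Ioi 1) :=
        (integrableOn_Ioi_rpow_of_lt (by linarith) one_pos).const_mul _
      refine Integrable.mono' hb ?_ ?_
      · apply AEStronglyMeasurable.mul hEm.aestronglyMeasurable
        apply ContinuousOn.aestronglyMeasurable _ measurableSet_Ioi
        intro t ht
        apply ContinuousAt.continuousWithinAt
        have : (0:ℝ) < t := lt_trans one_pos ht
        exact Complex.continuousAt_ofReal_cpow_const _ _ (Or.inr this.ne')
      · rw [ae_restrict_iff' measurableSet_Ioi]
        filter_upwards with t ht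
        have ht0 : (0:ℝ) < t := lt_trans one_pos ht
        rw [norm_mul, Complex.norm_cpow_eq_rpow_re_of_pos ht0]
        refine (mul_le_mul_of_nonneg_right (hEb t (le_of_lt ht)) (by positivity)).trans ?_
        rw [mul_assoc, ← Real.rpow_add ht0]
        apply le_of_eq; congr 2; simp; ring
    have e3 : ∫ t in Ioi (1:ℝ), (∑ k ∈ Finset.Icc 1 ⌊t⌋₊, (a k : ℂ)) * (t:ℂ) ^ (-(s + 1)) =
        κ / (s - 1) + ∫ t in Ioi (1:ℝ), E t * (t:ℂ) ^ (-(s + 1)) := by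
      have : κ / (s - 1) = ∫ t in Ioi (1:ℝ), (κ : ℂ) * (t:ℂ) ^ (-s) := by
        rw [integral_const_mul, integral_Ioi_cpow_of_lt (by simp; linarith) one_pos]
        simp
        have h2 : -s + 1 ≠ 0 := by intro h; apply hs1; linear_combination -h
        rw [mul_div_assoc', div_eq_div_iff hs1 h2]; ring
      rw [this, ← integral_add i1 i2]
      apply setIntegral_congr_fun measurableSet_Ioi
      intro t ht
      have ht0 : (0:ℝ) < t := lt_trans one_pos ht
      have ht1 : (t:ℂ) ≠ 0 := by exact_mod_cast ht0.ne'
      have : (t:ℂ) ^ (-s) = t * (t:ℂ) ^ (-(s+1)) := by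
        conv_rhs => rw [show -(s+1) = -s - 1 by ring, Complex.cpow_sub _ _ ht1, Complex.cpow_one]
        field_simp
      simp only [this, hE, hSd]
      push_cast
      ring
    simp only [e1, e3, e2]
    field_simp

/-- log derivative at a point -/
theorem logderiv_order {f : ℂ → ℂ} {z : ℂ} (hf : AnalyticAt ℂ f z) (hn : ¬ ∀ᶠ w in 𝓝 z, f w = 0) :
    ∃ n : ℕ, (n = 0 → f z ≠ 0) ∧ (f z ≠ 0 → n = 0) ∧ (∀ᶠ w in 𝓝[≠] z, f w ≠ 0) ∧
      Tendsto (fun w => (w - z) * (deriv f w / f w)) (𝓝[≠] z) (𝓝 n) := by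
  obtain ⟨n, g, hg, hg0, hfg⟩ := hf.exists_eventuallyEq_pow_smul_nonzero_iff.2 hn
  refine ⟨n, ?_, ?_, ?_, ?_⟩
  · rintro rfl
    rw [hfg.self_of_nhds]; simpa using hg0
  · intro h
    by_contra hne
    apply h; rw [hfg.self_of_nhds]; simp [hne]
  · have h1 : ∀ᶠ w in 𝓝 z, g w ≠ 0 := hg.continuousAt.eventually_ne hg0
    filter_upwards [nhdsWithin_le_nhds hfg, nhdsWithin_le_nhds h1, self_mem_nhdsWithin] with w h2 h3 h4
    rw [h2]
    exact smul_ne_zero (pow_ne_zero _ (sub_ne_zero.2 h4)) h3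
  · have h1 : ∀ᶠ w in 𝓝 z, g w ≠ 0 := hg.continuousAt.eventually_ne hg0
    have h5 : ∀ᶠ w in 𝓝 z, AnalyticAt ℂ g w := hg.eventually_analyticAt
    have h6 := hfg.eventually_nhds
    have lim : Tendsto (fun w => (n : ℂ) + (w - z) * (deriv g w / g w)) (𝓝[≠] z) (𝓝 n) := by
      have : ContinuousAt (fun w => (n : ℂ) + (w - z) * (deriv g w / g w)) z := by
        have := hg.deriv.continuousAt
        have := hg.continuousAt
        fun_prop (disch := assumption)
      have h := this.tendsto
      simp only [sub_self, zero_mul, add_zero] at h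
      exact h.mono_left nhdsWithin_le_nhds
    refine lim.congr' ?_
    filter_upwards [nhdsWithin_le_nhds h6, nhdsWithin_le_nhds h1, nhdsWithin_le_nhds h5,
      self_mem_nhdsWithin] with w h2 h3 h7 h4
    have hw : w - z ≠ 0 := sub_ne_zero.2 h4
    have hd : deriv f w = n * (w - z) ^ (n - 1) * g w + (w - z) ^ n * deriv g w := by
      rw [EventuallyEq.deriv_eq (f := fun w => (w - z) ^ n * g w) h2]
      have := ((((hasDerivAt_id w).sub_const z).pow n).mul h7.differentiableAt.hasDerivAt)
      refine (this.congr_deriv ?_).deriv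
      simp
    rw [hd, h2.self_of_nhds, smul_eq_mul]
    rcases n with _ | n
    · simp; 
    · simp only [Nat.add_sub_cancel]
      field_simp
      ring

end Z1
end PIT
end

section
open MeasureTheory Filter Topology Set

namespace PIT
section Z2

theorem three_four_one {c : ℕ → ℝ} (hc : ∀ n, 0 ≤ c n) {x : ℝ} (y : ℝ)
    (h : ∀ s : ℂ, s.re = x → LSeriesSummable (fun n => (c n : ℂ)) s) :
    0 ≤ (3 * LSeries (fun n => (c n : ℂ)) x + 4 * LSeries (fun n => (c n : ℂ)) (x + y * Complex.I) +
      LSeries (fun n => (c n : ℂ)) (x + 2 * y * Complex.I)).re := by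
  have h0 := h x (by simp)
  have h1 := h (x + y * Complex.I) (by simp)
  have h2 := h (x + 2 * y * Complex.I) (by simp)
  unfold LSeriesSummable at h0 h1 h2
  unfold LSeries
  rw [← tsum_mul_left, ← tsum_mul_left, ← (h0.mul_left 3).tsum_add (h1.mul_left 4),
    ← ((h0.mul_left 3).add (h1.mul_left 4)).tsum_add h2,
    Complex.re_tsum (((h0.mul_left 3).add (h1.mul_left 4)).add h2)]
  apply tsum_nonneg
  intro n
  rcases Nat.eq_zero_or_pos n with rfl | hn
  · simp
  have hn' : (0:ℝ) < n := by exact_mod_cast hn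
  have key : ∀ t : ℝ, (LSeries.term (fun n => (c n : ℂ)) (x + t * Complex.I) n).re =
      c n * ((n:ℝ) ^ (-x) * Real.cos (t * Real.log n)) := by
    intro t
    rw [LSeries.term_of_ne_zero hn.ne', div_eq_mul_inv, ← Complex.cpow_neg, Complex.re_ofReal_mul]
    congr 1
    rw [Complex.cpow_def_of_ne_zero (by exact_mod_cast hn.ne'), ← Complex.natCast_log,
      Complex.exp_re, Real.rpow_def_of_pos hn']
    have e1 : ((Real.log n : ℝ) : ℂ) * -(x + t * Complex.I) =
        ((-(Real.log n * x) : ℝ) : ℂ) + ((-(t * Real.log n) : ℝ) : ℂ) * Complex.I := by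
      push_cast; ring
    rw [e1]
    simp [-Complex.ofReal_neg, -Complex.ofReal_mul, Complex.add_re]
  have k0 := key 0
  have k1 := key y
  have k2 := key (2 * y)
  push_cast at k2
  simp only [Complex.ofReal_zero, zero_mul, add_zero, Real.cos_zero] at k0
  have r3 : ∀ z : ℂ, (3 * z).re = 3 * z.re := fun z => by simp
  have r4 : ∀ z : ℂ, (4 * z).re = 4 * z.re := fun z => by simp
  rw [Complex.add_re, Complex.add_re, r3, r4, k0, k1, k2, mul_assoc 2 y, Real.cos_two_mul]
  have : 3 * (c n * ((n:ℝ) ^ (-x) * 1)) + 4 * (c n * ((n:ℝ) ^ (-x) * Real.cos (y * Real.log n))) +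
      c n * ((n:ℝ) ^ (-x) * (2 * Real.cos (y * Real.log n) ^ 2 - 1)) =
      2 * (c n * (n:ℝ) ^ (-x)) * (1 + Real.cos (y * Real.log n)) ^ 2 := by ring
  rw [this]
  have := hc n
  positivity

theorem abstract_pnt {a c : ℕ → ℝ} (ha : ∀ n, 0 ≤ a n) {A κ δ : ℝ} (hA : 0 ≤ A) (hδ : 0 < δ)
    (hδ1 : δ < 1) (hκ : 0 < κ)
    (hS : ∀ t : ℝ, 1 ≤ t → |(∑ k ∈ Finset.Icc 1 ⌊t⌋₊, a k) - κ * t| ≤ A * t ^ (1 - δ))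
    (hc : ∀ n, 0 ≤ c n) (hc1 : c 1 = 0) {M : ℝ} (hM0 : 0 ≤ M)
    (hM : ∀ n : ℕ, ∑ k ∈ Finset.Icc 1 n, c k ≤ M * n)
    (hconv : ∀ n : ℕ, n ≠ 0 → Real.log n * a n = ∑ p ∈ n.divisorsAntidiagonal, c p.1 * a p.2) :
    Tendsto (fun x : ℝ => (∑ k ∈ Finset.Icc 1 ⌊x⌋₊, c k) / x) atTop (𝓝 1) := by
  obtain ⟨Z, hZd, hZ1, hZ⟩ := zeta_cont ha hA hδ hδ1 hκ hS
  set La := LSeries (fun n => (a n : ℂ)) with hLa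
  set Lc := LSeries (fun n => (c n : ℂ)) with hLc
  have hcs : ∀ s : ℂ, 1 < s.re → LSeriesSummable (fun n => (c n : ℂ)) s := by
    intro s hs
    refine LSeriesSummable_of_sum_norm_bigO_and_nonneg (r := 1) ?_ hc zero_le_one hs
    apply Asymptotics.IsBigO.of_bound M
    filter_upwards with n
    simp only [Real.rpow_one]
    rw [Real.norm_of_nonneg (Finset.sum_nonneg fun i _ => hc i),
      Real.norm_of_nonneg (Nat.cast_nonneg n)]
    exact hM n
  have habs : ∀ {f : ℕ → ℂ}, (∀ s : ℂ, 1 < s.re → LSeriesSummable f s) → ∀ s : ℂ, 1 < s.re →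
      LSeries.abscissaOfAbsConv f < s.re := by
    intro f hf s hs
    have : LSeries.abscissaOfAbsConv f ≤ (1:ℝ) :=
      LSeries.abscissaOfAbsConv_le_of_forall_lt_LSeriesSummable fun y hy => hf y (by simpa using hy)
    refine this.trans_lt ?_
    exact_mod_cast hs
  have hU : IsOpen {s : ℂ | 1 - δ < s.re} := isOpen_lt continuous_const Complex.continuous_re
  have hU1 : IsOpen {s : ℂ | 1 < s.re} := isOpen_lt continuous_const Complex.continuous_re
  have hZa : AnalyticOnNhd ℂ Z {s | 1 - δ < s.re} := hZd.analyticOnNhd hU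
  have hpre : IsPreconnected {s : ℂ | 1 - δ < s.re} := (convex_halfSpace_re_gt (1 - δ)).isPreconnected
  have hnz : ∀ s : ℂ, 1 - δ < s.re → ¬ ∀ᶠ w in 𝓝 s, Z w = 0 := by
    intro s hs h
    have := hZa.eqOn_zero_of_preconnected_of_eventuallyEq_zero hpre hs h
    exact hZ1 (this (by simp [hδ]))
  -- the log derivative
  have hlog : ∀ s : ℂ, 1 < s.re → deriv Z s = (1 / (s - 1) - Lc s) * Z s := by
    intro s hs
    have hs1 : s - 1 ≠ 0 := by
      intro h
      have : (s - 1).re = 0 := by rw [h]; simp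
      simp at this; linarith
    have h1 : Z =ᶠ[𝓝 s] fun w => (w - 1) * La w := by
      filter_upwards [hU1.mem_nhds hs] with w hw using (hZ w hw).2
    have hsa : ∀ s : ℂ, 1 < s.re → LSeriesSummable (fun n => (a n : ℂ)) s := fun s hs => (hZ s hs).1
    have h2 := LSeries_hasDerivAt (habs hsa s hs)
    have h3 : LSeries (LSeries.logMul fun n => (a n : ℂ)) s = Lc s * La s := by
      rw [hLc, hLa, ← LSeries_convolution' (hcs s hs) (hsa s hs)]
      apply LSeries_congr
      intro n hn
      rw [LSeries.convolution_def]
      have := hconv n hn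
      simp only [LSeries.logMul]
      rw [← Complex.natCast_log]
      exact_mod_cast this
    rw [h1.deriv_eq, (hZ s hs).2]
    have h4 := ((hasDerivAt_id s).sub_const 1).mul h2
    rw [h3] at h4
    refine (h4.congr_deriv ?_).deriv
    simp only [id, ← hLa]
    field_simp
    ring
  have hpunc : ∀ s : ℂ, Tendsto (fun e : ℝ => s + e) (𝓝[>] 0) (𝓝[≠] s) := by
    intro s
    apply tendsto_nhdsWithin_of_tendsto_nhds_of_eventually_within
    · have : Tendsto (fun e : ℝ => s + e) (𝓝 0) (𝓝 (s + (0:ℝ))) :=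
        Continuous.tendsto (by fun_prop) 0
      simp only [Complex.ofReal_zero, add_zero] at this
      exact this.mono_left nhdsWithin_le_nhds
    · filter_upwards [self_mem_nhdsWithin] with e he
      have : (0:ℝ) < e := he
      simp [this.ne']
  -- behaviour on the closed half plane
  have hord : ∀ s : ℂ, 1 ≤ s.re → ∃ n : ℕ, (n = 0 → Z s ≠ 0) ∧ (Z s ≠ 0 → n = 0) ∧
      Tendsto (fun e : ℝ => e * (1 / (s + e - 1) - Lc (s + e))) (𝓝[>] 0) (𝓝 (n : ℂ)) := by
    intro s hs
    have hs' : 1 - δ < s.re := by linarith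
    obtain ⟨n, h1, h2, h3, h4⟩ := logderiv_order (hZa s hs') (hnz s hs')
    refine ⟨n, h1, h2, ?_⟩
    refine (h4.comp (hpunc s)).congr' ?_
    filter_upwards [(hpunc s).eventually h3, self_mem_nhdsWithin] with e h5 he
    have he' : (0:ℝ) < e := he
    simp only [Function.comp]
    rw [hlog (s + e) (by simp; linarith), mul_div_assoc, div_self h5]
    ring
  have hnv : ∀ s : ℂ, 1 ≤ s.re → Z s ≠ 0 := by
    intro s hs
    rcases hs.lt_or_eq with hs1 | hs1
    · obtain ⟨n, h1, h2, h3⟩ := hord s hs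
      apply h1
      have hLcc : ContinuousAt Lc s := (LSeries_hasDerivAt (habs hcs s hs1)).continuousAt
      have hne : s - 1 ≠ 0 := by
        intro h
        have : (s - 1).re = 0 := by rw [h]; simp
        simp at this; linarith
      have : Tendsto (fun e : ℝ => (e:ℂ) * (1 / (s + e - 1) - Lc (s + e))) (𝓝[>] 0) (𝓝 0) := by
        have hc : ContinuousAt (fun e : ℝ => (e:ℂ) * (1 / (s + e - 1) - Lc (s + e))) 0 := by
          have h5 : ContinuousAt (fun e : ℝ => Lc (s + e)) 0 := by
            apply ContinuousAt.comp (g := Lc) (f := fun e : ℝ => s + e)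
            · simpa using hLcc
            · fun_prop
          have h6 : ContinuousAt (fun e : ℝ => 1 / (s + e - 1)) 0 := by
            apply ContinuousAt.div continuousAt_const (by fun_prop)
            simpa using hne
          exact (by fun_prop : ContinuousAt (fun e : ℝ => (e:ℂ)) 0).mul (h6.sub h5)
        have := hc.tendsto
        simp only [Complex.ofReal_zero, zero_mul] at this
        exact this.mono_left nhdsWithin_le_nhds
      exact_mod_cast tendsto_nhds_unique h3 this
    · by_cases hy : s.im = 0
      · have : s = 1 := Complex.ext (by simp [← hs1]) (by simp [hy])
        rw [this]; exact hZ1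
      set y := s.im with hyd
      have hs2 : s = 1 + y * Complex.I := by
        apply Complex.ext <;> simp [← hs1, hyd]
      obtain ⟨n0, _, h02, h03⟩ := hord 1 (by simp)
      obtain ⟨n1, h11, _, h13⟩ := hord s hs
      obtain ⟨n2, _, _, h23⟩ := hord (1 + 2 * y * Complex.I) (by simp)
      have hn0 : n0 = 0 := h02 hZ1
      subst hn0
      apply h11
      -- limits of e * Lc
      have hinv : ∀ t : ℝ, t ≠ 0 → Tendsto (fun e : ℝ => (e:ℂ) * (1 / (1 + t * Complex.I + e - 1)))
          (𝓝[>] 0) (𝓝 0) := by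
        intro t ht
        have hc : ContinuousAt (fun e : ℝ => (e:ℂ) * (1 / (1 + t * Complex.I + e - 1))) 0 := by
          apply ContinuousAt.mul (by fun_prop)
          apply ContinuousAt.div continuousAt_const (by fun_prop)
          simpa using ht
        have := hc.tendsto
        simp only [Complex.ofReal_zero, zero_mul] at this
        exact this.mono_left nhdsWithin_le_nhds
      have l0 : Tendsto (fun e : ℝ => (e:ℂ) * Lc (1 + e)) (𝓝[>] 0) (𝓝 (1 - (0:ℕ))) := by
        refine ((tendsto_const_nhds (x := (1:ℂ))).sub h03).congr' ?_
        filter_upwards [self_mem_nhdsWithin] with e he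
        have : (e:ℂ) ≠ 0 := by exact_mod_cast (ne_of_gt he)
        rw [add_sub_cancel_left]; field_simp; ring
      have l1 : Tendsto (fun e : ℝ => (e:ℂ) * Lc (1 + y * Complex.I + e)) (𝓝[>] 0) (𝓝 (0 - n1)) := by
        rw [hs2] at h13
        refine ((hinv y hy).sub h13).congr fun e => ?_
        ring
      have l2 : Tendsto (fun e : ℝ => (e:ℂ) * Lc (1 + 2 * y * Complex.I + e)) (𝓝[>] 0) (𝓝 (0 - n2)) := by
        have := hinv (2 * y) (by simpa using hy)
        push_cast at this
        refine (this.sub h23).congr fun e => ?_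
        ring
      have l := ((l0.const_mul 3).add (l1.const_mul 4)).add l2
      have l' := (Complex.continuous_re.tendsto _).comp l
      have hnn : 0 ≤ (3 * (1 - ((0:ℕ):ℂ)) + 4 * (0 - (n1:ℂ)) + (0 - (n2:ℂ))).re := by
        refine ge_of_tendsto l' ?_
        filter_upwards [self_mem_nhdsWithin] with e he
        have he' : (0:ℝ) < e := he
        have := three_four_one hc (x := 1 + e) y (fun s hs => hcs s (by linarith))
        have h7 : (3 * ((e:ℂ) * Lc (1 + e)) + 4 * ((e:ℂ) * Lc (1 + y * Complex.I + e)) +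
            (e:ℂ) * Lc (1 + 2 * y * Complex.I + e)) = (e : ℂ) * (3 * Lc ((1 + e : ℝ)) +
              4 * Lc ((1 + e : ℝ) + y * Complex.I) + Lc ((1 + e : ℝ) + 2 * y * Complex.I)) := by
          push_cast
          rw [show (1:ℂ) + e + y * Complex.I = 1 + y * Complex.I + e by ring,
            show (1:ℂ) + e + 2 * y * Complex.I = 1 + 2 * y * Complex.I + e by ring]
          ring
        simp only [Function.comp]
        rw [h7, Complex.re_ofReal_mul]
        exact mul_nonneg he'.le this
      simp at hnn
      have : (4 * n1 + n2 : ℝ) ≤ 3 := by linarith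
      have : 4 * n1 + n2 ≤ 3 := by exact_mod_cast this
      omega
  refine wiener_ikehara hc hc1 hM0 hM (A := 1) (g := fun z => - (deriv Z (1 + z) / Z (1 + z))) ?_ ?_
  · intro z hz
    apply ContinuousAt.continuousWithinAt
    have hz' : 0 ≤ z.re := hz
    have h1 : 1 - δ < (1 + z).re := by simp; linarith
    have h2 : ContinuousAt (fun z => deriv Z (1 + z)) z :=
      ContinuousAt.comp (g := deriv Z) (hZa _ h1).deriv.continuousAt (by fun_prop)
    have h3 : ContinuousAt (fun z => Z (1 + z)) z :=
      ContinuousAt.comp (g := Z) (hZa _ h1).continuousAt (by fun_prop)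
    exact (h2.div h3 (hnv _ (by simpa using hz'))).neg
  · intro s hs
    have h1 := hnv s hs.le
    rw [show 1 + (s - 1) = s by ring, hlog s hs, mul_div_assoc, div_self h1]
    simp [hLc]

end Z2
end PIT
end

section
open NumberField UniqueFactorizationMonoid

namespace PIT
section Z3

variable (K : Type*) [Field K] [NumberField K]

/-- ideals of norm n -/
noncomputable def FF (n : ℕ) : Finset (Ideal (𝓞 K)) :=
  (Ideal.finite_setOfPred_absNorm_eq (S := 𝓞 K) n).toFinset

variable {K}

theorem mem_FF {n : ℕ} {I : Ideal (𝓞 K)} : I ∈ FF K n ↔ Ideal.absNorm I = n := by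
  simp [FF]

open scoped Classical in
/-- von Mangoldt function on ideals -/
noncomputable def vI (I : Ideal (𝓞 K)) : ℝ :=
  if h : IsPrimePow I then Real.log (Ideal.absNorm h.choose) else 0

theorem vI_pow {P : Ideal (𝓞 K)} (hP : Prime P) {k : ℕ} (hk : 0 < k) :
    vI (P ^ k) = Real.log (Ideal.absNorm P) := by
  have h : IsPrimePow (P ^ k) := ⟨P, k, hP, hk, rfl⟩
  rw [vI, dif_pos h]
  obtain ⟨l, hQ, hl, he⟩ := h.choose_spec
  set Q := h.choose
  have h1 : P ∣ Q ^ l := by rw [he]; exact dvd_pow_self P hk.ne'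
  have h2 : P ∣ Q := hP.dvd_of_dvd_pow h1
  have h3 : P = Q := associated_iff_eq.1 (hP.associated_of_dvd hQ h2)
  rw [h3]

theorem vI_zero {I : Ideal (𝓞 K)} (h : ¬ IsPrimePow I) : vI I = 0 := by
  rw [vI, dif_neg h]

theorem vI_nonneg (I : Ideal (𝓞 K)) : 0 ≤ vI I := by
  by_cases h : IsPrimePow I
  · rw [vI, dif_pos h]; exact Real.log_natCast_nonneg _
  · rw [vI_zero h]

theorem pow_dvd_iff {P I : Ideal (𝓞 K)} (hP : Prime P) (hI : I ≠ ⊥) (k : ℕ) [DecidableEq (Ideal (𝓞 K))] :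
    P ^ k ∣ I ↔ k ≤ (normalizedFactors I).count P := by
  rw [dvd_iff_normalizedFactors_le_normalizedFactors (pow_ne_zero _ hP.ne_zero) hI,
    normalizedFactors_pow, normalizedFactors_irreducible hP.irreducible, normalize_eq,
    Multiset.nsmul_singleton, Multiset.le_count_iff_replicate_le]

theorem sum_vI {I : Ideal (𝓞 K)} (hI : I ≠ ⊥) (D : Finset (Ideal (𝓞 K))) (hD : ∀ J, J ∈ D ↔ J ∣ I) :
    ∑ J ∈ D, vI J = Real.log (Ideal.absNorm I) := by
  classical
  have hpr : ∀ P ∈ (normalizedFactors I).toFinset, Prime P := fun P hP =>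
    prime_of_normalized_factor P (Multiset.mem_toFinset.1 hP)
  have h1 : Real.log (Ideal.absNorm I) = ∑ P ∈ (normalizedFactors I).toFinset,
      ∑ k ∈ Finset.Icc 1 ((normalizedFactors I).count P), Real.log (Ideal.absNorm P) := by
    conv_lhs => rw [← Ideal.prod_normalizedFactors_eq_self hI, Finset.prod_multiset_count]
    rw [map_prod, Nat.cast_prod, Real.log_prod]
    · apply Finset.sum_congr rfl
      intro P hP
      rw [map_pow, Nat.cast_pow, Real.log_pow]
      simp
    · intro P hP
      rw [map_pow]
      have := (hpr P hP).ne_zero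
      exact_mod_cast pow_ne_zero _ (fun h => this (Ideal.absNorm_eq_zero_iff.1 h))
  rw [h1, Finset.sum_sigma']
  symm
  refine Finset.sum_of_injOn (fun x : (_ : Ideal (𝓞 K)) × ℕ => x.1 ^ x.2) ?_ ?_ ?_ ?_
  · rintro ⟨P, k⟩ hP ⟨Q, l⟩ hQ h
    simp only [Finset.coe_sigma, Set.mem_sigma_iff, Finset.mem_coe, Finset.mem_Icc] at hP hQ
    have h' : P ^ k = Q ^ l := h
    have hPp := hpr P hP.1
    have hQp := hpr Q hQ.1
    have h1 : P ∣ Q ^ l := by rw [← h']; exact dvd_pow_self P (by omega)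
    have h3 : P = Q := associated_iff_eq.1 (hPp.associated_of_dvd hQp (hPp.dvd_of_dvd_pow h1))
    subst h3
    have : k = l := pow_injective_of_not_isUnit hPp.not_isUnit hPp.ne_zero h'
    subst this
    rfl
  · rintro ⟨P, k⟩ hP
    simp only [Finset.coe_sigma, Set.mem_sigma_iff, Finset.mem_coe, Finset.mem_Icc] at hP
    rw [Finset.mem_coe, hD]
    exact (pow_dvd_iff (hpr P hP.1) hI k).2 hP.2.2
  · intro J hJ hJ2
    apply vI_zero
    rintro ⟨P, k, hP, hk, rfl⟩
    apply hJ2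
    have := (pow_dvd_iff hP hI k).1 ((hD _).1 hJ)
    refine ⟨⟨P, k⟩, ?_, rfl⟩
    simp only [Finset.coe_sigma, Set.mem_sigma_iff, Finset.mem_coe, Finset.mem_Icc]
    refine ⟨?_, hk, this⟩
    rw [Multiset.mem_toFinset, ← Multiset.count_pos]; omega
  · rintro ⟨P, k⟩ hP
    simp only [Finset.mem_sigma, Finset.mem_Icc] at hP
    exact (vI_pow (hpr P hP.1) hP.2.1).symm

variable (K) in
/-- von Mangoldt coefficients -/
noncomputable def vM (n : ℕ) : ℝ := ∑ I ∈ FF K n, vI I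

theorem vM_nonneg (n : ℕ) : 0 ≤ vM K n := Finset.sum_nonneg fun I _ => vI_nonneg I

theorem vM_one : vM K 1 = 0 := by
  apply Finset.sum_eq_zero
  intro I hI
  rw [mem_FF, Ideal.absNorm_eq_one_iff] at hI
  apply vI_zero
  rw [hI, ← Ideal.one_eq_top]
  exact not_isPrimePow_one

theorem conv_id (n : ℕ) (hn : n ≠ 0) : Real.log n * (FF K n).card =
    ∑ p ∈ n.divisorsAntidiagonal, vM K p.1 * (FF K p.2).card := by
  classical
  have hI0 : ∀ I ∈ FF K n, I ≠ ⊥ := by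
    rintro I hI rfl
    rw [mem_FF, Ideal.absNorm_bot] at hI
    exact hn hI.symm
  have hfin : ∀ I : Ideal (𝓞 K), I ≠ ⊥ → {J | J ∣ I}.Finite := by
    intro I hI
    have := UniqueFactorizationMonoid.fintypeSubtypeDvd I hI
    exact Set.finite_coe_iff.1 (Finite.of_fintype {J // J ∣ I})
  let D : Ideal (𝓞 K) → Finset (Ideal (𝓞 K)) := fun I => if h : I ≠ ⊥ then (hfin I h).toFinset else ∅
  have hD : ∀ I, I ≠ ⊥ → ∀ J, J ∈ D I ↔ J ∣ I := by
    intro I hI J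
    simp only [D, dif_pos hI]; simp
  have h1 : Real.log n * (FF K n).card = ∑ I ∈ FF K n, ∑ J ∈ D I, vI J := by
    rw [mul_comm, ← nsmul_eq_mul, ← Finset.sum_const]
    apply Finset.sum_congr rfl
    intro I hI
    rw [sum_vI (hI0 I hI) _ (hD I (hI0 I hI)), mem_FF.1 hI]
  have h2 : ∀ p : ℕ × ℕ, vM K p.1 * (FF K p.2).card = ∑ x ∈ FF K p.1 ×ˢ FF K p.2, vI x.1 := by
    intro p
    rw [Finset.sum_product, vM, Finset.sum_mul]
    apply Finset.sum_congr rfl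
    intro I hI
    simp [mul_comm]
  simp_rw [h1, h2]
  rw [Finset.sum_sigma', Finset.sum_sigma']
  symm
  refine Finset.sum_nbij (fun x : (_ : ℕ × ℕ) × (Ideal (𝓞 K) × Ideal (𝓞 K)) =>
    (⟨x.2.1 * x.2.2, x.2.1⟩ : (_ : Ideal (𝓞 K)) × Ideal (𝓞 K))) ?_ ?_ ?_ ?_
  · rintro ⟨p, J, J'⟩ h
    simp only [Finset.mem_sigma, Nat.mem_divisorsAntidiagonal, Finset.mem_product, mem_FF] at h
    have h3 : J * J' ∈ FF K n := by rw [mem_FF, map_mul, h.2.1, h.2.2, h.1.1]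
    simp only [Finset.mem_sigma]
    exact ⟨h3, (hD _ (hI0 _ h3) _).2 (dvd_mul_right _ _)⟩
  · rintro ⟨p, J, J'⟩ h ⟨q, I, I'⟩ h' he
    simp only [Finset.mem_coe, Finset.mem_sigma, Nat.mem_divisorsAntidiagonal, Finset.mem_product, mem_FF] at h h'
    simp only [Sigma.mk.injEq, heq_eq_eq] at he
    obtain ⟨he1, rfl⟩ := he
    have hJ : J ≠ 0 := by
      rintro rfl
      apply hn
      rw [← h.1.1, ← h.2.1]; simp
    have := mul_left_cancel₀ hJ he1
    subst this
    have : p = q := Prod.ext (by rw [← h.2.1, ← h'.2.1]) (by rw [← h.2.2, ← h'.2.2])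
    subst this
    rfl
  · rintro ⟨I, J⟩ h
    simp only [Finset.mem_coe, Finset.mem_sigma] at h
    obtain ⟨J', rfl⟩ := (hD _ (hI0 _ h.1) _).1 h.2
    refine ⟨⟨(Ideal.absNorm J, Ideal.absNorm J'), (J, J')⟩, ?_, rfl⟩
    simp only [Finset.mem_coe, Finset.mem_sigma, Nat.mem_divisorsAntidiagonal, Finset.mem_product, mem_FF]
    have := mem_FF.1 h.1
    rw [map_mul] at this
    exact ⟨⟨this, hn⟩, trivial, trivial⟩
  · rintro ⟨p, J, J'⟩ h
    rfl

end Z3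
end PIT
end

section
open NumberField UniqueFactorizationMonoid Filter Topology

namespace PIT
section Z4

variable {K : Type*} [Field K] [NumberField K]

theorem exists_prime_mem {P : Ideal (𝓞 K)} (hP : P.IsPrime) (h0 : P ≠ ⊥) : ∃ p : ℕ, p.Prime ∧ (p : 𝓞 K) ∈ P := by
  have h1 : ((Ideal.absNorm P : ℕ) : 𝓞 K) ∈ P := Ideal.absNorm_mem P
  have h2 : Ideal.absNorm P ≠ 0 := fun h => h0 (Ideal.absNorm_eq_zero_iff.1 h)
  rw [← Nat.prod_primeFactorsList h2, Nat.cast_list_prod, ← Multiset.prod_coe] at h1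
  obtain ⟨x, hx, hxP⟩ := (hP.multiset_prod_mem_iff_exists_mem _).1 h1
  obtain ⟨p, hp, rfl⟩ := List.mem_map.1 (Multiset.mem_coe.1 hx)
  exact ⟨p, Nat.prime_of_mem_primeFactorsList hp, hxP⟩

theorem norm_pow_prime {P : Ideal (𝓞 K)} {p : ℕ} (hp : p.Prime) (h : (p : 𝓞 K) ∈ P) :
    ∃ j : ℕ, Ideal.absNorm P = p ^ j := by
  have h1 : Ideal.absNorm P ∣ p ^ Module.finrank ℤ (𝓞 K) := by
    rw [← Ideal.absNorm_span_natCast]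
    apply Ideal.absNorm_dvd_absNorm_of_le
    rw [Ideal.span_singleton_le_iff_mem]; exact h
  obtain ⟨j, _, hj⟩ := (Nat.dvd_prime_pow hp).1 h1
  exact ⟨j, hj⟩

theorem vM_le (n : ℕ) : vM K n ≤ Module.finrank ℤ (𝓞 K) * ArithmeticFunction.vonMangoldt n := by
  classical
  set G := (FF K n).filter IsPrimePow with hG
  have hsum : vM K n = ∑ I ∈ G, vI I := by
    rw [vM, hG, Finset.sum_filter]
    apply Finset.sum_congr rfl
    intro I hI
    split_ifs with h
    · rfl
    · exact vI_zero h
  rcases G.eq_empty_or_nonempty with hE | ⟨I0, hI0⟩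
  · rw [hsum, hE, Finset.sum_empty]
    exact mul_nonneg (Nat.cast_nonneg _) ArithmeticFunction.vonMangoldt_nonneg
  -- root
  have hroot : ∀ I ∈ G, ∃ P : Ideal (𝓞 K), ∃ k : ℕ, Prime P ∧ 0 < k ∧ P ^ k = I := by
    intro I hI; exact (Finset.mem_filter.1 hI).2
  choose! r k hr hk hrk using hroot
  have hN : ∀ I ∈ G, Ideal.absNorm (r I) ^ k I = n := by
    intro I hI
    rw [← map_pow, hrk I hI]
    exact mem_FF.1 (Finset.mem_filter.1 hI).1
  have hprime : ∀ I ∈ G, (r I).IsPrime := fun I hI => Ideal.isPrime_of_prime (hr I hI)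
  obtain ⟨p, hp, hpm⟩ := exists_prime_mem (hprime I0 hI0) (hr I0 hI0).ne_zero
  obtain ⟨j, hj⟩ := norm_pow_prime hp hpm
  have hn : n = p ^ (j * k I0) := by rw [pow_mul, ← hj, hN I0 hI0]
  have hne1 : ∀ I ∈ G, Ideal.absNorm (r I) ≠ 1 := by
    intro I hI h
    rw [Ideal.absNorm_eq_one_iff] at h
    exact (hprime I hI).ne_top h
  have hj0 : j ≠ 0 := by
    rintro rfl
    exact hne1 I0 hI0 (by simpa using hj)
  have hjk : j * k I0 ≠ 0 := mul_ne_zero hj0 (hk I0 hI0).ne'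
  -- all roots contain p
  have hmem : ∀ I ∈ G, (p : 𝓞 K) ∈ r I := by
    intro I hI
    obtain ⟨q, hq, hqm⟩ := exists_prime_mem (hprime I hI) (hr I hI).ne_zero
    obtain ⟨i, hi⟩ := norm_pow_prime hq hqm
    have h1 := hN I hI
    rw [hi, ← pow_mul] at h1
    have hi0 : i ≠ 0 := by
      rintro rfl
      exact hne1 I hI (by simpa using hi)
    have h2 : q ∣ p ^ (j * k I0) := by
      rw [← hn, ← h1]; exact dvd_pow_self q (mul_ne_zero hi0 (hk I hI).ne')
    have h3 : q = p := (Nat.prime_dvd_prime_iff_eq hq hp).1 (hq.dvd_of_dvd_pow h2)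
    rwa [← h3]
  have hinj : Set.InjOn r G := by
    intro I hI J hJ h
    have h1 := hN I hI
    have h2 := hN J hJ
    rw [h, ← h2] at h1
    have h3 : 1 < Ideal.absNorm (r J) := by
      have := hne1 J hJ
      have h4 : Ideal.absNorm (r J) ≠ 0 := fun h => (hr J hJ).ne_zero (Ideal.absNorm_eq_zero_iff.1 h)
      omega
    have h5 := Nat.pow_right_injective h3 h1
    rw [← hrk I hI, ← hrk J hJ, h, h5]
  have hdvd : ∏ P ∈ G.image r, P ∣ Ideal.span {(p : 𝓞 K)} := by
    apply Finset.prod_primes_dvd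
    · intro P hP
      obtain ⟨I, hI, rfl⟩ := Finset.mem_image.1 hP
      exact hr I hI
    · intro P hP
      obtain ⟨I, hI, rfl⟩ := Finset.mem_image.1 hP
      rw [Ideal.dvd_span_singleton]; exact hmem I hI
  have hdvd2 : ∏ I ∈ G, Ideal.absNorm (r I) ∣ p ^ Module.finrank ℤ (𝓞 K) := by
    rw [← Ideal.absNorm_span_natCast, ← map_prod, ← Finset.prod_image (f := fun x => x) hinj]
    exact map_dvd _ hdvd
  have hle := Nat.le_of_dvd (pow_pos hp.pos _) hdvd2
  have hnz : ∀ I ∈ G, ((Ideal.absNorm (r I) : ℕ) : ℝ) ≠ 0 := by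
    intro I hI
    exact_mod_cast fun h => (hr I hI).ne_zero (Ideal.absNorm_eq_zero_iff.1 h)
  have hlog : ∑ I ∈ G, vI I = Real.log ((∏ I ∈ G, Ideal.absNorm (r I) : ℕ) : ℝ) := by
    rw [Nat.cast_prod, Real.log_prod hnz]
    apply Finset.sum_congr rfl
    intro I hI
    rw [← vI_pow (hr I hI) (hk I hI), hrk I hI]
  rw [hsum, hlog, hn, ArithmeticFunction.vonMangoldt_apply_pow hjk,
    ArithmeticFunction.vonMangoldt_apply_prime hp, ← Real.log_pow]
  apply Real.log_le_log
  · have : 0 < ∏ I ∈ G, Ideal.absNorm (r I) := Finset.prod_pos fun I hI => by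
      have := hnz I hI
      exact Nat.pos_of_ne_zero (by exact_mod_cast this)
    exact_mod_cast this
  · exact_mod_cast hle

theorem vM_prime {p : ℕ} (hp : p.Prime) : vM K p = (FF K p).card * Real.log p := by
  rw [vM, ← nsmul_eq_mul, ← Finset.sum_const]
  apply Finset.sum_congr rfl
  intro I hI
  have hN := mem_FF.1 hI
  have h1 : I.IsPrime := Ideal.isPrime_of_irreducible_absNorm (by rw [hN]; exact hp)
  have h0 : I ≠ ⊥ := by
    rintro rfl
    rw [Ideal.absNorm_bot] at hN
    exact hp.ne_zero hN.symm
  have := vI_pow ((Ideal.prime_iff_isPrime h0).2 h1) one_pos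
  rw [pow_one] at this
  rw [this, hN]

theorem idc_eq (s : ℝ) (hs : 0 ≤ s) : (idc K s : ℝ) = ∑ k ∈ Finset.Icc 1 ⌊s⌋₊, ((FF K k).card : ℝ) := by
  classical
  have hd : Set.PairwiseDisjoint (↑(Finset.Icc 1 ⌊s⌋₊)) (FF K) := by
    intro a _ b _ hab
    rw [Function.onFun, Finset.disjoint_left]
    intro I h1 h2
    rw [mem_FF] at h1 h2
    exact hab (h1.symm.trans h2)
  rw [← Nat.cast_sum, ← Finset.card_biUnion hd]
  congr 1
  rw [idc]
  have e : {I : nonZeroDivisors (Ideal (𝓞 K)) // (Ideal.absNorm (I : Ideal (𝓞 K)) : ℝ) ≤ s} ≃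
      {I // I ∈ (Finset.Icc 1 ⌊s⌋₊).biUnion (FF K)} := by
    refine Equiv.ofBijective (fun I => ⟨I.1.1, ?_⟩) ⟨?_, ?_⟩
    · have h0 : I.1.1 ≠ ⊥ := nonZeroDivisors.coe_ne_zero I.1
      rw [Finset.mem_biUnion]
      refine ⟨_, ?_, mem_FF.2 rfl⟩
      rw [Finset.mem_Icc]
      exact ⟨Nat.one_le_iff_ne_zero.2 fun h => h0 (Ideal.absNorm_eq_zero_iff.1 h), Nat.le_floor I.2⟩
    · intro I J h
      simp only [Subtype.mk.injEq] at h
      exact Subtype.ext (Subtype.ext h)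
    · rintro ⟨I, hI⟩
      obtain ⟨k, hk, hIk⟩ := Finset.mem_biUnion.1 hI
      rw [mem_FF] at hIk
      rw [Finset.mem_Icc] at hk
      have h0 : I ≠ 0 := by
        rintro rfl
        rw [Ideal.zero_eq_bot, Ideal.absNorm_bot] at hIk
        omega
      refine ⟨⟨⟨I, mem_nonZeroDivisors_of_ne_zero h0⟩, ?_⟩, rfl⟩
      simp only [hIk]
      exact (Nat.cast_le.2 hk.2).trans (Nat.floor_le hs)
  rw [Nat.card_congr e, Nat.card_eq_fintype_card, Fintype.card_coe]

theorem pnt_psi : Tendsto (fun x : ℝ => (∑ k ∈ Finset.Icc 1 ⌊x⌋₊, vM K k) / x) atTop (𝓝 1) := by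
  obtain ⟨A, κ, δ, hA, hκ, hδ, hδ1, h⟩ := idc_est K
  refine abstract_pnt (a := fun n => ((FF K n).card : ℝ)) (fun n => Nat.cast_nonneg _) hA hδ hδ1 hκ ?_
    vM_nonneg vM_one (M := Module.finrank ℤ (𝓞 K) * (Real.log 4 + 4)) (by positivity) ?_ conv_id
  · intro t ht
    rw [← idc_eq t (by linarith)]
    exact h t ht
  · intro n
    calc ∑ k ∈ Finset.Icc 1 n, vM K k ≤ ∑ k ∈ Finset.Icc 1 n,
          Module.finrank ℤ (𝓞 K) * ArithmeticFunction.vonMangoldt k :=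
            Finset.sum_le_sum fun k _ => vM_le k
      _ = Module.finrank ℤ (𝓞 K) * Chebyshev.psi n := by
        rw [← Finset.mul_sum, Chebyshev.psi, Nat.floor_natCast]; rfl
      _ ≤ _ := by
        rw [mul_assoc]
        exact mul_le_mul_of_nonneg_left (Chebyshev.psi_le_const_mul_self (Nat.cast_nonneg n)) (Nat.cast_nonneg _)

end Z4
end PIT
end

section
open NumberField Filter Topology

namespace PIT
section P1

variable (K : Type*) [Field K] [NumberField K]

/-- degree one prime count -/
noncomputable def pi1 (x : ℝ) : ℕ := ∑ p ∈ (Finset.Icc 1 ⌊x⌋₊).filter Nat.Prime, (FF K p).card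

/-- degree one theta -/
noncomputable def th1 (x : ℝ) : ℝ :=
  ∑ p ∈ (Finset.Icc 1 ⌊x⌋₊).filter Nat.Prime, ((FF K p).card : ℝ) * Real.log p

theorem log_div_rpow {r : ℝ} (hr : 0 < r) : Tendsto (fun x : ℝ => Real.log x / x ^ r) atTop (𝓝 0) :=
  (isLittleO_log_rpow_atTop hr).tendsto_div_nhds_zero

theorem th1_lim : Tendsto (fun x : ℝ => th1 K x / x) atTop (𝓝 1) := by
  set d : ℝ := (Module.finrank ℤ (𝓞 K) : ℝ) with hd
  have hd0 : 0 ≤ d := Nat.cast_nonneg _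
  have hlim : Tendsto (fun x : ℝ => 2 * d * (Real.log x / x ^ (1/2 : ℝ))) atTop (𝓝 0) := by
    simpa using (log_div_rpow (r := 1/2) (by norm_num)).const_mul (2 * d)
  have hdiff : ∀ x : ℝ, (∑ k ∈ Finset.Icc 1 ⌊x⌋₊, vM K k) - th1 K x =
      ∑ k ∈ (Finset.Icc 1 ⌊x⌋₊).filter (fun n => ¬ Nat.Prime n), vM K k := by
    intro x
    rw [← Finset.sum_filter_add_sum_filter_not _ Nat.Prime, th1, sub_eq_iff_eq_add, add_comm]
    congr 1
    apply Finset.sum_congr rfl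
    intro p hp
    exact vM_prime (Finset.mem_filter.1 hp).2
  have hle : ∀ x : ℝ, 1 ≤ x → (∑ k ∈ Finset.Icc 1 ⌊x⌋₊, vM K k) - th1 K x ≤
      2 * d * (Real.sqrt x * Real.log x) := by
    intro x hx
    rw [hdiff]
    calc _ ≤ ∑ k ∈ (Finset.Icc 1 ⌊x⌋₊).filter (fun n => ¬ Nat.Prime n),
          d * ArithmeticFunction.vonMangoldt k := Finset.sum_le_sum fun k _ => vM_le k
      _ = d * (Chebyshev.psi x - Chebyshev.theta x) := by
        rw [← Finset.mul_sum, Chebyshev.psi_sub_theta_eq_sum_not_prime]; rfl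
      _ ≤ d * (2 * Real.sqrt x * Real.log x) :=
        mul_le_mul_of_nonneg_left (Chebyshev.psi_sub_theta_le hx) hd0
      _ = _ := by ring
  have hsq : Tendsto (fun x : ℝ => ((∑ k ∈ Finset.Icc 1 ⌊x⌋₊, vM K k) - th1 K x) / x) atTop (𝓝 0) := by
    refine squeeze_zero' ?_ ?_ hlim
    · filter_upwards [eventually_ge_atTop 0] with x hx
      rw [hdiff]
      exact div_nonneg (Finset.sum_nonneg fun k _ => vM_nonneg k) hx
    · filter_upwards [eventually_ge_atTop 1] with x hx
      have hx0 : 0 < x := by linarith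
      rw [div_le_iff₀ hx0]
      refine (hle x hx).trans (le_of_eq ?_)
      rw [← Real.sqrt_eq_rpow]
      have h1 : x = Real.sqrt x * Real.sqrt x := (Real.mul_self_sqrt hx0.le).symm
      have h2 : Real.sqrt x ≠ 0 := (Real.sqrt_pos.2 hx0).ne'
      generalize Real.log x = l at *
      conv_rhs => rw [mul_assoc]; arg 2; arg 2; rw [h1]
      field_simp
  have := (pnt_psi (K := K)).sub hsq
  simp only [sub_zero] at this
  refine this.congr fun x => ?_
  ring

theorem card_FF_le {p : ℕ} (hp : p.Prime) : ((FF K p).card : ℝ) ≤ Module.finrank ℤ (𝓞 K) := by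
  have h := vM_le (K := K) p
  rw [vM_prime hp, ArithmeticFunction.vonMangoldt_apply_prime hp] at h
  exact le_of_mul_le_mul_right h (Real.log_pos (by exact_mod_cast hp.one_lt))

theorem pi1_lim : Tendsto (fun x : ℝ => (pi1 K x : ℝ) * Real.log x / x) atTop (𝓝 1) := by
  set d : ℝ := (Module.finrank ℤ (𝓞 K) : ℝ) with hd
  have hd0 : 0 ≤ d := Nat.cast_nonneg _
  refine tendsto_order.2 ⟨fun a ha => ?_, fun b hb => ?_⟩
  · filter_upwards [(tendsto_order.1 (th1_lim K)).1 a ha, eventually_ge_atTop 1] with x hx hx1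
    refine hx.trans_le ?_
    have hx0 : 0 < x := by linarith
    apply div_le_div_of_nonneg_right _ hx0.le
    rw [th1, pi1, Nat.cast_sum, Finset.sum_mul]
    apply Finset.sum_le_sum
    intro p hp
    rw [Finset.mem_filter, Finset.mem_Icc] at hp
    apply mul_le_mul_of_nonneg_left _ (Nat.cast_nonneg _)
    apply Real.log_le_log (by exact_mod_cast hp.1.1)
    exact (Nat.cast_le.2 hp.1.2).trans (Nat.floor_le hx0.le)
  · obtain ⟨ε, hε, hε1, hεb⟩ : ∃ ε : ℝ, 0 < ε ∧ ε < 1 ∧ 1 / (1 - ε) < b := by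
      refine ⟨(1 - 1 / b) / 2, ?_, ?_, ?_⟩
      · have : 1 / b < 1 := by rw [div_lt_one (by linarith)]; exact hb
        linarith
      · have : 0 < 1 / b := by positivity
        linarith
      · have hb0 : 0 < b := by linarith
        have h1 : 1 / b < 1 := by rw [div_lt_one (by linarith)]; exact hb
        have h3 : 0 < 1 / b := by positivity
        rw [div_lt_iff₀ (by linarith)]
        have h2 : b * (1 / b) = 1 := by field_simp
        nlinarith
    have hlim : Tendsto (fun x : ℝ => d * (Real.log x / x ^ ε) + (th1 K x / x) * (1 / (1 - ε))) atTop
        (𝓝 (d * 0 + 1 * (1 / (1 - ε)))) :=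
      ((log_div_rpow hε).const_mul d).add ((th1_lim K).mul_const _)
    filter_upwards [(tendsto_order.1 hlim).2 b (by simpa using hεb), eventually_gt_atTop 1] with x hx hx1
    refine lt_of_le_of_lt ?_ hx
    have hx0 : 0 < x := by linarith
    have hlx : 0 < Real.log x := Real.log_pos hx1
    have hε' : 0 < 1 - ε := by linarith
    have hterm : ∀ p ∈ (Finset.Icc 1 ⌊x⌋₊).filter Nat.Prime, ((FF K p).card : ℝ) * Real.log x ≤
        (if (p:ℝ) ≤ x ^ (1 - ε) then d * Real.log x else 0) +
          ((FF K p).card : ℝ) * Real.log p * (1 / (1 - ε)) := by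
      intro p hp
      rw [Finset.mem_filter, Finset.mem_Icc] at hp
      have hp1 : (1:ℝ) ≤ p := by exact_mod_cast hp.1.1
      have h0 : 0 ≤ ((FF K p).card : ℝ) * Real.log p * (1 / (1 - ε)) := by
        have := Real.log_nonneg hp1
        positivity
      split_ifs with h
      · have := mul_le_mul_of_nonneg_right (card_FF_le K hp.2) hlx.le
        linarith
      · rw [zero_add, mul_assoc]
        apply mul_le_mul_of_nonneg_left _ (Nat.cast_nonneg _)
        rw [mul_one_div, le_div_iff₀ hε', mul_comm, ← Real.log_rpow hx0]
        exact Real.log_le_log (by positivity) (not_le.1 h).le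
    have hsum : (pi1 K x : ℝ) * Real.log x ≤ x ^ (1 - ε) * (d * Real.log x) + th1 K x * (1 / (1 - ε)) := by
      rw [pi1, Nat.cast_sum, Finset.sum_mul]
      refine (Finset.sum_le_sum hterm).trans ?_
      rw [Finset.sum_add_distrib, th1, ← Finset.sum_mul]
      apply add_le_add_left
      rw [← Finset.sum_filter, Finset.sum_const, nsmul_eq_mul]
      apply mul_le_mul_of_nonneg_right _ (by positivity)
      have hsub : ((Finset.Icc 1 ⌊x⌋₊).filter Nat.Prime).filter (fun p : ℕ => (p:ℝ) ≤ x ^ (1 - ε)) ⊆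
          Finset.Icc 1 ⌊x ^ (1 - ε)⌋₊ := by
        intro p hp
        rw [Finset.mem_filter, Finset.mem_filter, Finset.mem_Icc] at hp
        rw [Finset.mem_Icc]
        exact ⟨hp.1.1.1, Nat.le_floor hp.2⟩
      have := Finset.card_le_card hsub
      rw [Nat.card_Icc, Nat.add_sub_cancel] at this
      exact (Nat.cast_le.2 this).trans (Nat.floor_le (by positivity))
    calc (pi1 K x : ℝ) * Real.log x / x ≤
        (x ^ (1 - ε) * (d * Real.log x) + th1 K x * (1 / (1 - ε))) / x :=
          div_le_div_of_nonneg_right hsum hx0.le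
      _ = _ := by
        rw [Real.rpow_sub hx0, Real.rpow_one]
        have : x ^ ε ≠ 0 := (by positivity : 0 < x ^ ε).ne'
        field_simp

/-- logarithmic integral -/
theorem li_lim : Tendsto (fun x : ℝ => (∫ t in (2:ℝ)..x, 1 / Real.log t) * Real.log x / x) atTop (𝓝 1) := by
  have hform : ∀ x : ℝ, 2 ≤ x → ∫ t in (2:ℝ)..x, 1 / Real.log t =
      x / Real.log x - 2 / Real.log 2 + ∫ t in (2:ℝ)..x, 1 / Real.log t ^ 2 := by
    intro x hx
    have hpos : ∀ t ∈ Set.uIcc 2 x, 0 < Real.log t ∧ t ≠ 0 := by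
      intro t ht
      rw [Set.uIcc_of_le hx] at ht
      exact ⟨Real.log_pos (by linarith [ht.1]), by linarith [ht.1]⟩
    have i2 := Chebyshev.intervalIntegrable_one_div_log_sq (a := 2) (b := x) (by norm_num) (by linarith)
    have i1 : IntervalIntegrable (fun t => 1 / Real.log t) MeasureTheory.volume 2 x := by
      apply ContinuousOn.intervalIntegrable
      intro t ht
      apply ContinuousAt.continuousWithinAt
      exact continuousAt_const.div (Real.continuousAt_log (hpos t ht).2) (hpos t ht).1.ne'
    have := intervalIntegral.integral_eq_sub_of_hasDerivAt (f := fun t => t / Real.log t)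
      (f' := fun t => 1 / Real.log t - 1 / Real.log t ^ 2) (a := 2) (b := x) (fun t ht => by
        obtain ⟨h1, h2⟩ := hpos t ht
        refine ((hasDerivAt_id t).div (Real.hasDerivAt_log h2) h1.ne').congr_deriv ?_
        have := h1.ne'
        simp only [id]
        field_simp) (i1.sub i2)
    rw [intervalIntegral.integral_sub i1 i2] at this
    linarith
  have h1 : Tendsto (fun x : ℝ => Real.log x / x) atTop (𝓝 0) := by
    simpa using log_div_rpow (r := 1) one_pos
  have h2 : Tendsto (fun x : ℝ => (∫ t in (2:ℝ)..x, 1 / Real.log t ^ 2) * (Real.log x / x)) atTop (𝓝 0) := by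
    have hO := Chebyshev.integral_one_div_log_sq_isBigO.mul
      (Asymptotics.isBigO_refl (fun x : ℝ => Real.log x / x) atTop)
    refine hO.trans_tendsto ?_
    refine (Real.tendsto_log_atTop.inv_tendsto_atTop).congr' ?_
    filter_upwards [eventually_gt_atTop 1] with x hx
    have := (Real.log_pos hx).ne'
    have h0 : x ≠ 0 := by linarith
    simp only [Pi.inv_apply]
    field_simp
  have h3 : Tendsto (fun x : ℝ => 1 - 2 / Real.log 2 * (Real.log x / x) +
      (∫ t in (2:ℝ)..x, 1 / Real.log t ^ 2) * (Real.log x / x)) atTop (𝓝 (1 - 2 / Real.log 2 * 0 + 0)) :=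
    ((h1.const_mul _).const_sub 1).add h2
  simp only [mul_zero, sub_zero, add_zero] at h3
  refine h3.congr' ?_
  filter_upwards [eventually_ge_atTop 2] with x hx
  rw [hform x hx]
  have := (Real.log_pos (by linarith : 1 < x)).ne'
  have h0 : x ≠ 0 := by linarith
  generalize (∫ t in (2:ℝ)..x, 1 / Real.log t ^ 2) = J
  generalize 2 / Real.log 2 = c
  field_simp

end P1
end PIT
end

section
open NumberField Filter Topology

namespace PIT
section Q1

variable (L K : Type*) [Field L] [Field K] [NumberField L] [NumberField K] [Algebra L K]

theorem FF_isPrime {p : ℕ} (hp : p.Prime) {I : Ideal (𝓞 K)} (hI : I ∈ FF K p) : I.IsPrime := by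
  rw [mem_FF] at hI
  exact Ideal.isPrime_of_irreducible_absNorm (by rw [hI]; exact hp)

theorem FF_ne_bot {p : ℕ} (hp : p.Prime) {I : Ideal (𝓞 K)} (hI : I ∈ FF K p) : I ≠ ⊥ := by
  rintro rfl
  rw [mem_FF, Ideal.absNorm_bot] at hI
  exact hp.ne_zero hI.symm

theorem FF_isMax {p : ℕ} (hp : p.Prime) {I : Ideal (𝓞 K)} (hI : I ∈ FF K p) : I.IsMaximal :=
  (FF_isPrime K hp hI).isMaximal (FF_ne_bot K hp hI)

theorem comap_mem {p : ℕ} (hp : p.Prime) {Q : Ideal (𝓞 K)} (hQ : Q ∈ FF K p) :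
    Q.comap (algebraMap (𝓞 L) (𝓞 K)) ∈ FF L p := by
  have hQp := FF_isPrime K hp hQ
  have hd : Ideal.absNorm (Q.comap (algebraMap (𝓞 L) (𝓞 K))) ∣ p := by
    rw [← mem_FF.1 hQ]
    exact AddSubgroup.card_dvd_of_injective
      (Ideal.quotientMap Q (algebraMap (𝓞 L) (𝓞 K)) le_rfl).toAddMonoidHom
      (Ideal.quotientMap_injective)
  rw [mem_FF]
  rcases (Nat.dvd_prime hp).1 hd with h | h
  · rw [Ideal.absNorm_eq_one_iff] at h
    exact absurd h (hQp.comap _).ne_top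
  · exact h

theorem norm_map (hdeg : Module.finrank L K = 2) {p : ℕ} {P : Ideal (𝓞 L)} (hP : P ∈ FF L p) :
    Ideal.absNorm (P.map (algebraMap (𝓞 L) (𝓞 K))) = p ^ 2 := by
  rw [Ideal.absNorm_algebraMap (R := 𝓞 L) (S := 𝓞 K) P,
    (IsFractionRing.finrank_eq (𝓞 L) L (𝓞 K) K).symm, hdeg, mem_FF.1 hP]

theorem comap_iff {p : ℕ} (hp : p.Prime) {P : Ideal (𝓞 L)} (hP : P ∈ FF L p)
    {Q : Ideal (𝓞 K)} (hQ : Q ∈ FF K p) :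
    Q.comap (algebraMap (𝓞 L) (𝓞 K)) = P ↔ Q ∣ P.map (algebraMap (𝓞 L) (𝓞 K)) := by
  rw [Ideal.dvd_iff_le, Ideal.map_le_iff_le_comap]
  constructor
  · intro h; rw [h]
  · intro h
    exact ((FF_isMax L hp hP).eq_of_le ((FF_isPrime K hp hQ).comap _).ne_top h).symm

open Classical in
theorem fib_inert (hdeg : Module.finrank L K = 2) {p : ℕ} (hp : p.Prime) {P : Ideal (𝓞 L)}
    (hP : P ∈ FF L p) (hi : (P.map (algebraMap (𝓞 L) (𝓞 K))).IsPrime) :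
    ((FF K p).filter (fun Q => Q.comap (algebraMap (𝓞 L) (𝓞 K)) = P)).card = 0 := by
  rw [Finset.card_eq_zero, Finset.filter_eq_empty_iff]
  intro Q hQ h
  rw [comap_iff L K hp hP hQ, Ideal.dvd_iff_le] at h
  have hn := norm_map L K hdeg hP
  have h0 : P.map (algebraMap (𝓞 L) (𝓞 K)) ≠ ⊥ := by
    intro h0
    rw [h0, Ideal.absNorm_bot] at hn
    exact pow_ne_zero 2 hp.ne_zero hn.symm
  have := (hi.isMaximal h0).eq_of_le (FF_isPrime K hp hQ).ne_top h
  rw [this, mem_FF.1 hQ] at hn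
  have := hp.one_lt
  nlinarith

open Classical in
theorem fib_split (hdeg : Module.finrank L K = 2) {p : ℕ} (hp : p.Prime) {P : Ideal (𝓞 L)}
    (hP : P ∈ FF L p) (hi : ¬ (P.map (algebraMap (𝓞 L) (𝓞 K))).IsPrime) :
    ((FF K p).filter (fun Q => Q.comap (algebraMap (𝓞 L) (𝓞 K)) = P)).card ≤ 2 ∧
    2 ≤ ((FF K p).filter (fun Q => Q.comap (algebraMap (𝓞 L) (𝓞 K)) = P)).card +
      (((FF K p).filter (fun Q => Q ∣ differentIdeal (𝓞 L) (𝓞 K))).filter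
        (fun Q => Q.comap (algebraMap (𝓞 L) (𝓞 K)) = P)).card := by
  have hn := norm_map L K hdeg hP
  have h1 : P.map (algebraMap (𝓞 L) (𝓞 K)) ≠ ⊤ := by
    intro h0
    rw [h0, Ideal.absNorm_top] at hn
    exact (one_lt_pow₀ hp.one_lt two_ne_zero).ne hn
  obtain ⟨Q, hQm, hQ⟩ := Ideal.exists_le_maximal _ h1
  rw [← Ideal.dvd_iff_le] at hQ
  obtain ⟨Q', hQ'⟩ := hQ
  have hmul : Ideal.absNorm Q * Ideal.absNorm Q' = p ^ 2 := by rw [← hn, hQ', map_mul]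
  have hQ1 : Ideal.absNorm Q ≠ 1 := by
    rw [Ne, Ideal.absNorm_eq_one_iff]; exact hQm.ne_top
  have hQ'1 : Ideal.absNorm Q' ≠ 1 := by
    rw [Ne, Ideal.absNorm_eq_one_iff]
    rintro rfl
    apply hi
    rw [hQ', Ideal.mul_top]
    exact hQm.isPrime
  obtain ⟨hQF, hQ'F⟩ : Ideal.absNorm Q = p ∧ Ideal.absNorm Q' = p :=
    (hp.mul_eq_prime_sq_iff hQ1 hQ'1).1 hmul
  rw [← mem_FF] at hQF hQ'F
  have hfib : (FF K p).filter (fun Q => Q.comap (algebraMap (𝓞 L) (𝓞 K)) = P) = {Q, Q'} := by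
    ext R
    simp only [Finset.mem_filter, Finset.mem_insert, Finset.mem_singleton]
    constructor
    · rintro ⟨hR, hRP⟩
      rw [comap_iff L K hp hP hR, hQ'] at hRP
      have hRp : Prime R := Ideal.prime_of_isPrime (FF_ne_bot K hp hR) (FF_isPrime K hp hR)
      rcases hRp.dvd_or_dvd hRP with h | h
      · left
        exact ((FF_isMax K hp hQF).eq_of_le (FF_isPrime K hp hR).ne_top (Ideal.dvd_iff_le.1 h)).symm
      · right
        exact ((FF_isMax K hp hQ'F).eq_of_le (FF_isPrime K hp hR).ne_top (Ideal.dvd_iff_le.1 h)).symm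
    · rintro (rfl | rfl)
      · exact ⟨hQF, (comap_iff L K hp hP hQF).2 (hQ' ▸ dvd_mul_right _ _)⟩
      · exact ⟨hQ'F, (comap_iff L K hp hP hQ'F).2 (hQ' ▸ dvd_mul_left _ _)⟩
  refine ⟨hfib ▸ Finset.card_le_two, ?_⟩
  by_cases h : Q = Q'
  · have hd : Q ∣ differentIdeal (𝓞 L) (𝓞 K) := by
      have := FF_isMax L hp hP
      have h2 : Q ^ 2 ∣ P.map (algebraMap (𝓞 L) (𝓞 K)) := by rw [hQ', ← h, sq]
      simpa using pow_sub_one_dvd_differentIdeal (A := 𝓞 L) (B := 𝓞 K) Q 2 (FF_ne_bot L hp hP) h2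
    have hm : Q ∈ (FF K p).filter (fun Q => Q.comap (algebraMap (𝓞 L) (𝓞 K)) = P) := by
      rw [hfib]; simp
    have a := Finset.card_pos.2 ⟨Q, hm⟩
    have b : 0 < (((FF K p).filter (fun Q => Q ∣ differentIdeal (𝓞 L) (𝓞 K))).filter
        (fun Q => Q.comap (algebraMap (𝓞 L) (𝓞 K)) = P)).card := by
      apply Finset.card_pos.2 ⟨Q, _⟩
      simp only [Finset.mem_filter] at hm ⊢
      exact ⟨⟨hm.1, hd⟩, hm.2⟩
    omega
  · rw [hfib, Finset.card_pair h]; omega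

open Classical in
theorem local_count (hdeg : Module.finrank L K = 2) {p : ℕ} (hp : p.Prime) :
    (FF K p).card + 2 * ((FF L p).filter
        (fun P => (P.map (algebraMap (𝓞 L) (𝓞 K))).IsPrime)).card ≤ 2 * (FF L p).card ∧
    2 * (FF L p).card ≤ (FF K p).card + 2 * ((FF L p).filter
        (fun P => (P.map (algebraMap (𝓞 L) (𝓞 K))).IsPrime)).card +
      ((FF K p).filter (fun Q => Q ∣ differentIdeal (𝓞 L) (𝓞 K))).card := by
  have e1 := Finset.card_eq_sum_card_fiberwise (s := FF K p) (t := FF L p)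
    (f := fun Q => Q.comap (algebraMap (𝓞 L) (𝓞 K))) (fun Q hQ => comap_mem L K hp hQ)
  have e2 := Finset.card_eq_sum_card_fiberwise
    (s := (FF K p).filter (fun Q => Q ∣ differentIdeal (𝓞 L) (𝓞 K))) (t := FF L p)
    (f := fun Q => Q.comap (algebraMap (𝓞 L) (𝓞 K)))
    (fun Q hQ => comap_mem L K hp (Finset.mem_filter.1 hQ).1)
  rw [e1, e2, Finset.card_filter, Finset.card_eq_sum_ones (FF L p), Finset.mul_sum, Finset.mul_sum,
    ← Finset.sum_add_distrib, ← Finset.sum_add_distrib]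
  constructor
  · refine Finset.sum_le_sum fun P hP => ?_
    by_cases h : (P.map (algebraMap (𝓞 L) (𝓞 K))).IsPrime
    · have := fib_inert L K hdeg hp hP h
      simp only [h, if_true]; omega
    · have := (fib_split L K hdeg hp hP h).1
      simp only [h, if_false]; omega
  · refine Finset.sum_le_sum fun P hP => ?_
    by_cases h : (P.map (algebraMap (𝓞 L) (𝓞 K))).IsPrime
    · simp only [h, if_true]; omega
    · have := (fib_split L K hdeg hp hP h).2
      simp only [h, if_false]; omega

open Classical in
/-- inert count -/
noncomputable def fin1 (x : ℝ) : ℕ := ∑ p ∈ (Finset.Icc 1 ⌊x⌋₊).filter Nat.Prime,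
  ((FF L p).filter (fun P => (P.map (algebraMap (𝓞 L) (𝓞 K))).IsPrime)).card

open Classical in
theorem global_count (hdeg : Module.finrank L K = 2) : ∃ C : ℕ, ∀ x : ℝ,
    pi1 K x + 2 * fin1 L K x ≤ 2 * pi1 L x ∧ 2 * pi1 L x ≤ pi1 K x + 2 * fin1 L K x + C := by
  have hne : differentIdeal (𝓞 L) (𝓞 K) ≠ ⊥ := differentIdeal_ne_bot
  have hfin : {J : Ideal (𝓞 K) | J ∣ differentIdeal (𝓞 L) (𝓞 K)}.Finite := by
    have := UniqueFactorizationMonoid.fintypeSubtypeDvd (differentIdeal (𝓞 L) (𝓞 K)) hne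
    exact Set.finite_coe_iff.1 (Finite.of_fintype {J // J ∣ differentIdeal (𝓞 L) (𝓞 K)})
  refine ⟨hfin.toFinset.card, fun x => ⟨?_, ?_⟩⟩
  · unfold pi1 fin1
    rw [Finset.mul_sum, Finset.mul_sum, ← Finset.sum_add_distrib]
    exact Finset.sum_le_sum fun p hp => (local_count L K hdeg (Finset.mem_filter.1 hp).2).1
  · have hC : ∑ p ∈ (Finset.Icc 1 ⌊x⌋₊).filter Nat.Prime,
        ((FF K p).filter (fun Q => Q ∣ differentIdeal (𝓞 L) (𝓞 K))).card ≤ hfin.toFinset.card := by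
      rw [← Finset.card_biUnion]
      · apply Finset.card_le_card
        intro Q hQ
        simp only [Finset.mem_biUnion, Finset.mem_filter] at hQ
        obtain ⟨p, -, -, h⟩ := hQ
        exact hfin.mem_toFinset.2 h
      · intro p _ q _ hpq
        rw [Function.onFun, Finset.disjoint_left]
        intro Q h1 h2
        simp only [Finset.mem_filter, mem_FF] at h1 h2
        exact hpq (h1.1.symm.trans h2.1)
    refine le_trans ?_ (Nat.add_le_add_left hC _)
    unfold pi1 fin1
    rw [Finset.mul_sum, Finset.mul_sum, ← Finset.sum_add_distrib, ← Finset.sum_add_distrib]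
    exact Finset.sum_le_sum fun p hp => (local_count L K hdeg (Finset.mem_filter.1 hp).2).2

open Classical in
theorem fin1_eq (x : ℝ) : ({P : Ideal (𝓞 L) | P.IsPrime ∧ P ≠ ⊥ ∧ (Ideal.absNorm P).Prime ∧
          ((Ideal.absNorm P : ℝ) ≤ x) ∧
          (Ideal.map (algebraMap (𝓞 L) (𝓞 K)) P).IsPrime}).ncard = fin1 L K x := by
  unfold fin1
  rw [← Finset.card_biUnion]
  · rw [← Set.ncard_coe_finset]
    congr 1
    ext P
    simp only [Set.mem_ofPred_eq, Finset.coe_biUnion, Finset.coe_filter, Set.mem_iUnion,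
      Finset.mem_coe, Finset.mem_filter, Finset.mem_Icc, exists_prop]
    constructor
    · rintro ⟨h1, h2, h3, h4, h5⟩
      exact ⟨Ideal.absNorm P, ⟨⟨h3.one_lt.le, Nat.le_floor h4⟩, h3⟩, mem_FF.2 rfl, h5⟩
    · rintro ⟨p, ⟨⟨h1, h2⟩, h3⟩, h4, h5⟩
      have hn := mem_FF.1 h4
      refine ⟨FF_isPrime L h3 h4, FF_ne_bot L h3 h4, hn ▸ h3, ?_, h5⟩
      rw [hn]
      exact (Nat.le_floor_iff' h3.ne_zero).1 h2
  · intro p _ q _ hpq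
    rw [Function.onFun, Finset.disjoint_left]
    intro Q h1 h2
    simp only [Finset.mem_filter, mem_FF] at h1 h2
    exact hpq (h1.1.symm.trans h2.1)

theorem final (hdeg : Module.finrank L K = 2) :
    Tendsto (fun x : ℝ => (fin1 L K x : ℝ) / ((1 / 2) * ∫ t in (2 : ℝ)..x, 1 / Real.log t))
      atTop (𝓝 1) := by
  obtain ⟨C, hC⟩ := global_count L K hdeg
  have hl : Tendsto (fun x : ℝ => Real.log x / x) atTop (𝓝 0) := by
    simpa using log_div_rpow (r := 1) one_pos
  have hA : Tendsto (fun x => 2 * ((pi1 L x : ℝ) * Real.log x / x) - (pi1 K x : ℝ) * Real.log x / x)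
      atTop (𝓝 1) := by
    have := ((pi1_lim L).const_mul 2).sub (pi1_lim K)
    norm_num at this; exact this
  have hB := hA.sub (hl.const_mul (C : ℝ))
  rw [mul_zero, sub_zero] at hB
  have hpos : ∀ᶠ x : ℝ in atTop, 0 < Real.log x / x := by
    filter_upwards [eventually_gt_atTop 1] with x hx
    exact div_pos (Real.log_pos hx) (by linarith)
  have hF : Tendsto (fun x => 2 * (fin1 L K x : ℝ) * (Real.log x / x)) atTop (𝓝 1) := by
    refine tendsto_of_tendsto_of_tendsto_of_le_of_le' hB hA ?_ ?_
    · filter_upwards [hpos] with x hx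
      have h : (2 * pi1 L x : ℝ) ≤ pi1 K x + 2 * fin1 L K x + C := by exact_mod_cast (hC x).2
      have := mul_le_mul_of_nonneg_right h hx.le
      simp only [mul_div_assoc]
      linarith
    · filter_upwards [hpos] with x hx
      have h : (pi1 K x + 2 * fin1 L K x : ℝ) ≤ 2 * pi1 L x := by exact_mod_cast (hC x).1
      have := mul_le_mul_of_nonneg_right h hx.le
      simp only [mul_div_assoc]
      linarith
  have hD := hF.div li_lim one_ne_zero
  rw [div_one] at hD
  refine hD.congr' ?_
  filter_upwards [hpos] with x hx
  simp only [Pi.div_apply]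
  rw [mul_div_assoc (∫ t in (2 : ℝ)..x, 1 / Real.log t), mul_div_mul_right _ _ hx.ne']
  rw [one_div, inv_mul_eq_div, div_div_eq_mul_div, mul_comm]

end Q1
end PIT
end

open NumberField

/-- Chebotarev for a quadratic extension K/L of number fields:
the number of degree-1 primes 𝔓 of 𝒪_L of norm ≤ x that remain inert in K
is asymptotic to (1/2)·Li(x). -/
theorem half_of_degree_one_primes_inert_in_quadratic_extension
    (L K : Type) [Field L] [Field K] [NumberField L] [NumberField K]
    [Algebra L K] (hdeg : Module.finrank L K = 2)
    (f : ℝ → ℕ)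
    (hf : ∀ x : ℝ, f x =
      ({P : Ideal (𝓞 L) | P.IsPrime ∧ P ≠ ⊥ ∧ (Ideal.absNorm P).Prime ∧
          ((Ideal.absNorm P : ℝ) ≤ x) ∧
          (Ideal.map (algebraMap (𝓞 L) (𝓞 K)) P).IsPrime}).ncard) :
    Filter.Tendsto
      (fun x : ℝ => (f x : ℝ) / ((1 / 2) * ∫ t in (2 : ℝ)..x, 1 / Real.log t))
      Filter.atTop (nhds 1) := by
  simp only [hf, PIT.fin1_eq]
  exact PIT.final L K hdeg
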